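/- arXiv:2604.04365 — 2 statements merged into one kernel-verified Lean document; each statement's English description precedes it below -/
import Mathlib

section
/- Under the featured correlated Gaussian Wigner model G(n,d,ρ,r), suppose n·log(1/(1−ρ²)) + d·log(1/(1−r²)) ≥ (4+ε)·log n for some constant 0 < ε < 1. Then for all sufficiently large n and any integer k with 1 ≤ k ≤ εn/16, the maximum likelihood estimator π̂ ∈ argmax_{π∈S_n} S_π(G1,G2) satisfies P[d(π̂, π*) = k] ≤ exp(−(ε/8)·k·log n). -/
open MeasureTheory ProbabilityTheory Filter
open scoped ENNReal

namespace FCGW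

/-- `phi x = x / (1 - x^2)`, the weight function `φ` from the paper. -/
noncomputable def phi (x : ℝ) : ℝ := x / (1 - x ^ 2)

/-- The edge set of the complete graph on `Fin n`: non-diagonal unordered pairs. -/
abbrev Edge (n : ℕ) := {e : Sym2 (Fin n) // ¬ e.IsDiag}

lemma map_not_isDiag {n : ℕ} (π : Equiv.Perm (Fin n)) (e : Sym2 (Fin n)) :
    ¬ e.IsDiag → ¬ (Sym2.map π e).IsDiag := by
  induction e using Sym2.ind with
  | _ x y =>
    simp only [Sym2.map_pair_eq, Sym2.mk_isDiag_iff]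
    exact fun he h => he (π.injective h)

/-- Action of a vertex permutation on edges: `π({u,v}) = {π(u), π(v)}`. -/
def edgeMap {n : ℕ} (π : Equiv.Perm (Fin n)) (e : Edge n) : Edge n :=
  ⟨Sym2.map π e.1, map_not_isDiag π e.1 e.2⟩

/-- The observation space: edge weights of `G1`, edge weights of `G2`,
features of `G1`, features of `G2`. -/
abbrev Obs (n d : ℕ) :=
  (Edge n → ℝ) × (Edge n → ℝ) × (Fin n → Fin d → ℝ) × (Fin n → Fin d → ℝ)

/-- The law of a pair of jointly Gaussian standard normals with correlation `ρ`,
i.e. a centered Gaussian vector in `ℝ²` with covariance `[[1, ρ], [ρ, 1]]`. -/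
noncomputable def gaussianPair (ρ : ℝ) : Measure (ℝ × ℝ) :=
  Measure.map (fun z : ℝ × ℝ => (z.1, ρ * z.1 + Real.sqrt (1 - ρ ^ 2) * z.2))
    ((gaussianReal 0 1).prod (gaussianReal 0 1))

/-- The law `N(0, Σ_d)` with `Σ_d = [[I_d, r I_d], [r I_d, I_d]]` of a correlated
feature pair `(x, y) ∈ ℝ^d × ℝ^d`. -/
noncomputable def featurePair (d : ℕ) (r : ℝ) : Measure ((Fin d → ℝ) × (Fin d → ℝ)) :=
  Measure.map (fun z : (Fin d → ℝ) × (Fin d → ℝ) =>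
      (z.1, fun i => r * z.1 i + Real.sqrt (1 - r ^ 2) * z.2 i))
    ((Measure.pi fun _ : Fin d => gaussianReal 0 1).prod
      (Measure.pi fun _ : Fin d => gaussianReal 0 1))

/-- The underlying randomness of the featured correlated Gaussian Wigner model:
independent correlated Gaussian pairs for each edge of `G1` and independent
correlated feature pairs for each vertex of `G1`. -/
noncomputable def sample (n d : ℕ) (ρ r : ℝ) :
    Measure ((Edge n → ℝ × ℝ) × (Fin n → (Fin d → ℝ) × (Fin d → ℝ))) :=
  (Measure.pi fun _ : Edge n => gaussianPair ρ).prod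
    (Measure.pi fun _ : Fin n => featurePair d r)

/-- The observations `(β(G1), β(G2), x, y)` produced from the underlying
randomness when the latent vertex correspondence is `πs`: the pair at edge `e`
gives the weight of `e` in `G1` and of `πs(e)` in `G2`, and the feature pair at a
vertex `v` gives the feature of `v` in `G1` and of `πs(v)` in `G2`. -/
noncomputable def obsOf {n d : ℕ} (πs : Equiv.Perm (Fin n))
    (ω : (Edge n → ℝ × ℝ) × (Fin n → (Fin d → ℝ) × (Fin d → ℝ))) : Obs n d :=
  (fun e => (ω.1 e).1,
   fun f => (ω.1 (edgeMap πs⁻¹ f)).2,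
   fun v => (ω.2 v).1,
   fun v => (ω.2 (πs⁻¹ v)).2)

/-- The law of the observed pair of featured graphs `(G1, G2)` under the featured
correlated Gaussian Wigner model `G(n, d, ρ, r)` with latent correspondence `πs`. -/
noncomputable def obsLaw (n d : ℕ) (ρ r : ℝ) (πs : Equiv.Perm (Fin n)) :
    Measure (Obs n d) :=
  Measure.map (obsOf πs) (sample n d ρ r)

/-- The similarity score
`S_π = φ(ρ) Σ_e β_e(G1) β_{π(e)}(G2) + φ(r) Σ_v ⟪x_v, y_{π(v)}⟫`. -/
noncomputable def score {n d : ℕ} (ρ r : ℝ) (o : Obs n d) (π : Equiv.Perm (Fin n)) : ℝ :=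
  phi ρ * ∑ e : Edge n, o.1 e * o.2.1 (edgeMap π e)
    + phi r * ∑ v : Fin n, ∑ i : Fin d, o.2.2.1 v i * o.2.2.2 (π v) i

/-- `overlap(π, π') = |{v : π v = π' v}| / n`. -/
noncomputable def overlap {n : ℕ} (π π' : Equiv.Perm (Fin n)) : ℝ :=
  ((Finset.univ.filter fun v => π v = π' v).card : ℝ) / n

/-- The Hamming distance `d(π, π') = |{v : π v ≠ π' v}|`. -/
def hamming {n : ℕ} (π π' : Equiv.Perm (Fin n)) : ℕ :=
  (Finset.univ.filter fun v => π v ≠ π' v).card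

instance {n : ℕ} : MeasurableSpace (Equiv.Perm (Fin n)) := ⊤

/-- The Bayesian joint law of `(π*, (G1, G2))` when `π*` is uniform on `S_n`. -/
noncomputable def bayesLaw (n d : ℕ) (ρ r : ℝ) :
    Measure (Equiv.Perm (Fin n) × Obs n d) :=
  (Nat.factorial n : ℝ≥0∞)⁻¹ •
    ∑ π : Equiv.Perm (Fin n), Measure.map (fun o => (π, o)) (obsLaw n d ρ r π)

lemma lint_prod {ι : Type*} [Fintype ι] (f : ι → ℝ → ℝ≥0∞) (hf : ∀ i, Measurable (f i)) :
    ∫⁻ x, ∏ i, f i (x i) ∂(Measure.pi fun _ : ι => gaussianReal 0 1)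
      = ∏ i, ∫⁻ z, f i z ∂(gaussianReal 0 1) := by
  rw [lintegral_prod_eq_prod_lintegral_of_indepFun Finset.univ
    (fun i (x : ι → ℝ) => f i (x i))]
  · refine Finset.prod_congr rfl fun i _ => ?_
    exact (measurePreserving_eval (fun _ : ι => gaussianReal 0 1) i).lintegral_comp (hf i)
  · exact iIndepFun_pi (fun i => (hf i).aemeasurable)
  · intro i
    exact (hf i).comp (measurable_pi_apply i)

lemma lint_exp (t : ℝ) :
    ∫⁻ z, ENNReal.ofReal (Real.exp (t * z)) ∂(gaussianReal 0 1)
      = ENNReal.ofReal (Real.exp (t ^ 2 / 2)) := by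
  rw [← ofReal_integral_eq_lintegral_ofReal (integrable_exp_mul_gaussianReal t)
    (ae_of_all _ fun x => (Real.exp_pos _).le)]
  have := congrFun (mgf_fun_id_gaussianReal (μ := 0) (v := 1)) t
  simp only [mgf] at this
  rw [this]
  simp

lemma lint_sq (a : ℝ) (ha : 0 ≤ a) :
    ∫⁻ z, ENNReal.ofReal (Real.exp (-(a * z ^ 2))) ∂(gaussianReal 0 1)
      = ENNReal.ofReal ((1 + 2 * a) ^ (-(1 / 2) : ℝ)) := by
  rw [← ofReal_integral_eq_lintegral_ofReal _ (ae_of_all _ fun x => (Real.exp_pos _).le)]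
  · congr 1
    rw [integral_gaussianReal_eq_integral_smul (by norm_num)]
    have : ∀ x : ℝ, gaussianPDFReal 0 1 x • Real.exp (-(a * x ^ 2))
        = (√(2 * Real.pi))⁻¹ * Real.exp (-(1 / 2 + a) * x ^ 2) := by
      intro x
      simp only [gaussianPDFReal, smul_eq_mul, NNReal.coe_one, mul_one, sub_zero]
      rw [mul_assoc, ← Real.exp_add]
      congr 2
      ring
    simp_rw [this]
    rw [integral_const_mul, integral_gaussian, Real.rpow_neg (by positivity),
      ← Real.sqrt_eq_rpow, ← Real.sqrt_inv, ← Real.sqrt_inv, ← Real.sqrt_mul (by positivity)]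
    congr 1
    have := Real.pi_pos.ne'
    have : 1 + 2 * a ≠ 0 := by positivity
    have : 1 / 2 + a ≠ 0 := by positivity
    field_simp
  · refine Integrable.of_bound (by fun_prop) 1 (ae_of_all _ fun x => ?_)
    rw [Real.norm_eq_abs, abs_of_pos (Real.exp_pos _), Real.exp_le_one_iff]
    have := mul_nonneg ha (sq_nonneg x)
    linarith

lemma pow_concave (c l : ℝ) (hc : 0 ≤ c) (hl : 0 ≤ l) (hl4 : l ≤ 4) :
    (1 + 2 * (c * l)) ^ (-(1 / 2) : ℝ) ≤ (1 + 8 * c) ^ (-(l / 8) : ℝ) := by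
  have h1 : (1 + 8 * c) ^ (l / 4 : ℝ) ≤ 1 + 2 * (c * l) := by
    have := rpow_one_add_le_one_add_mul_self (s := 8 * c) (by linarith) (p := l / 4)
      (by linarith) (by linarith)
    linarith
  have h2 : (1 + 8 * c) ^ (-(l / 8) : ℝ) = ((1 + 8 * c) ^ (l / 4 : ℝ)) ^ (-(1 / 2) : ℝ) := by
    rw [← Real.rpow_mul (by linarith)]
    congr 1
    ring
  rw [h2]
  exact Real.rpow_le_rpow_of_nonpos (Real.rpow_pos_of_pos (by linarith) _) h1 (by norm_num)

lemma spectral {ι : Type*} [Fintype ι] [DecidableEq ι] (σ : Equiv.Perm ι) (c : ℝ) (hc : 0 ≤ c) :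
    ∫⁻ x, ENNReal.ofReal (Real.exp (-(c * ∑ e, (x (σ e) - x e) ^ 2)))
        ∂(Measure.pi fun _ : ι => gaussianReal 0 1)
      ≤ ENNReal.ofReal ((1 + 8 * c) ^
          (-(((Finset.univ.filter fun e => σ e ≠ e).card : ℝ) / 4))) := by
  let U : (EuclideanSpace ℝ ι) ≃ₗᵢ[ℝ] (EuclideanSpace ℝ ι) := LinearIsometryEquiv.piLpCongrLeft 2 ℝ ℝ σ.symm
  have hU : ∀ (x : (EuclideanSpace ℝ ι)) e, U x e = x (σ e) := by
    intro x e
    rw [LinearIsometryEquiv.piLpCongrLeft_apply]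
    simp [Equiv.piCongrLeft']
  let D : (EuclideanSpace ℝ ι) →ₗ[ℝ] (EuclideanSpace ℝ ι) := U.toLinearEquiv.toLinearMap - LinearMap.id
  have hD : ∀ x : (EuclideanSpace ℝ ι), D x = U x - x := fun x => rfl
  let T : (EuclideanSpace ℝ ι) →ₗ[ℝ] (EuclideanSpace ℝ ι) := LinearMap.adjoint D ∘ₗ D
  have hT : T.IsSymmetric := by
    intro x y
    simp only [T, LinearMap.comp_apply]
    rw [LinearMap.adjoint_inner_left, LinearMap.adjoint_inner_right]
  have hTi : ∀ x y : (EuclideanSpace ℝ ι), inner ℝ x (T y) = inner ℝ (D x) (D y) := by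
    intro x y
    simp only [T, LinearMap.comp_apply]
    rw [LinearMap.adjoint_inner_right]
  have hn : Module.finrank ℝ (EuclideanSpace ℝ ι) = Fintype.card ι := by simp
  let b := hT.eigenvectorBasis hn
  let l := hT.eigenvalues hn
  have hb : ∀ i, T (b i) = l i • b i := fun i => by
    exact hT.apply_eigenvectorBasis hn i
  have hDb : ∀ i j, inner ℝ (D (b i)) (D (b j)) = if i = j then l j else 0 := by
    intro i j
    rw [← hTi, hb, inner_smul_right, orthonormal_iff_ite.mp b.orthonormal i j]
    simp
  have hl : ∀ i, l i = ‖D (b i)‖ ^ 2 := by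
    intro i
    rw [← real_inner_self_eq_norm_sq, hDb]
    simp
  have hl0 : ∀ i, 0 ≤ l i := fun i => by rw [hl]; positivity
  have hl4 : ∀ i, l i ≤ 4 := fun i => by
    have : ‖D (b i)‖ ≤ 2 := by
      rw [hD]
      refine (norm_sub_le _ _).trans ?_
      rw [U.norm_map, b.norm_eq_one]
      norm_num
    rw [hl]
    nlinarith [norm_nonneg (D (b i))]
  have htr : ∑ i, l i = 2 * ((Finset.univ.filter fun e => σ e ≠ e).card : ℝ) := by
    have h1 : ∑ i, l i = T.trace ℝ (EuclideanSpace ℝ ι) := by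
      rw [LinearMap.trace_eq_sum_inner T b]
      refine Finset.sum_congr rfl fun i _ => ?_
      rw [hTi, hDb]
      simp
    rw [h1, LinearMap.trace_eq_sum_inner T (EuclideanSpace.basisFun ι ℝ)]
    have h2 : ∀ e, inner ℝ (EuclideanSpace.basisFun ι ℝ e) (T (EuclideanSpace.basisFun ι ℝ e))
        = if σ e ≠ e then (2 : ℝ) else 0 := by
      intro e
      rw [hTi, hD, EuclideanSpace.basisFun_apply, real_inner_self_eq_norm_sq]
      have hUe : U (EuclideanSpace.single e (1 : ℝ)) = EuclideanSpace.single (σ.symm e) (1 : ℝ) := by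
        ext f
        rw [hU]
        simp [Equiv.eq_symm_apply, Pi.single_apply]
      rw [hUe]
      by_cases h : σ e = e
      · have : σ.symm e = e := by rw [Equiv.symm_apply_eq, h]
        simp [h, this]
      · have h' : σ.symm e ≠ e := by
          intro h'
          rw [Equiv.symm_apply_eq] at h'
          exact h h'.symm
        rw [norm_sub_sq_real]
        simp [h, h', EuclideanSpace.inner_single_left]
        norm_num
    rw [Finset.sum_congr rfl fun e _ => h2 e]
    rw [Finset.sum_ite]
    simp [mul_comm]
  have hq : ∀ x : Fin (Fintype.card ι) → ℝ, ‖D (∑ i, x i • b i)‖ ^ 2 = ∑ i, l i * x i ^ 2 := by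
    intro x
    rw [map_sum, ← real_inner_self_eq_norm_sq, sum_inner]
    refine Finset.sum_congr rfl fun i _ => ?_
    rw [inner_sum]
    simp only [map_smul, inner_smul_left, inner_smul_right, hDb]
    simp
    ring
  have hDx : ∀ x : ι → ℝ, ∑ e, (x (σ e) - x e) ^ 2 = ‖D (WithLp.toLp 2 x)‖ ^ 2 := by
    intro x
    rw [EuclideanSpace.real_norm_sq_eq]
    refine Finset.sum_congr rfl fun e _ => ?_
    rw [hD, PiLp.sub_apply, hU]
  have hDc : Continuous D := D.continuous_of_finiteDimensional
  have hm : Measurable fun y : (EuclideanSpace ℝ ι) => ENNReal.ofReal (Real.exp (-(c * ‖D y‖ ^ 2))) := by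
    have : Continuous fun y : (EuclideanSpace ℝ ι) => Real.exp (-(c * ‖D y‖ ^ 2)) := by fun_prop
    exact this.measurable.ennreal_ofReal
  calc _ = ∫⁻ x, ENNReal.ofReal (Real.exp (-(c * ‖D (WithLp.toLp 2 x)‖ ^ 2)))
        ∂(Measure.pi fun _ : ι => gaussianReal 0 1) := by simp_rw [hDx]
    _ = ∫⁻ y, ENNReal.ofReal (Real.exp (-(c * ‖D y‖ ^ 2))) ∂(stdGaussian (EuclideanSpace ℝ ι)) := by
        rw [← map_pi_eq_stdGaussian, lintegral_map hm (by fun_prop)]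
    _ = ∫⁻ x, ∏ i, ENNReal.ofReal (Real.exp (-((c * l i) * x i ^ 2)))
        ∂(Measure.pi fun _ : Fin (Fintype.card ι) => gaussianReal 0 1) := by
        rw [stdGaussian_eq_map_pi_orthonormalBasis b, lintegral_map hm (by fun_prop)]
        refine lintegral_congr fun x => ?_
        rw [hq, ← ENNReal.ofReal_prod_of_nonneg (fun _ _ => (Real.exp_pos _).le), ← Real.exp_sum,
          Finset.sum_neg_distrib, Finset.mul_sum]
        simp_rw [mul_assoc]
    _ = ∏ i, ENNReal.ofReal ((1 + 2 * (c * l i)) ^ (-(1 / 2) : ℝ)) := by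
        rw [lint_prod (fun i z => ENNReal.ofReal (Real.exp (-((c * l i) * z ^ 2))))
          (fun i => by fun_prop)]
        exact Finset.prod_congr rfl fun i _ => lint_sq _ (mul_nonneg hc (hl0 i))
    _ ≤ ∏ i, ENNReal.ofReal ((1 + 8 * c) ^ (-(l i / 8) : ℝ)) :=
        Finset.prod_le_prod' fun i _ =>
          ENNReal.ofReal_le_ofReal (pow_concave c (l i) hc (hl0 i) (hl4 i))
    _ = _ := by
        rw [← ENNReal.ofReal_prod_of_nonneg (fun _ _ => Real.rpow_nonneg (by linarith) _),
          ← Real.rpow_sum_of_pos (by linarith), Finset.sum_neg_distrib, ← Finset.sum_div, htr]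
        congr 3
        ring

lemma two_stage {ι : Type*} [Fintype ι] [DecidableEq ι] (σ : Equiv.Perm ι) (ρ : ℝ)
    (h0 : 0 < ρ) (h1 : ρ < 1) :
    ∫⁻ z, ENNReal.ofReal (Real.exp (phi ρ / 2 * ∑ e, z.1 e *
        ((ρ * z.1 (σ e) + √(1 - ρ ^ 2) * z.2 (σ e)) - (ρ * z.1 e + √(1 - ρ ^ 2) * z.2 e))))
        ∂((Measure.pi fun _ : ι => gaussianReal 0 1).prod (Measure.pi fun _ : ι => gaussianReal 0 1))
      ≤ ENNReal.ofReal ((1 - ρ ^ 2) ^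
          (((Finset.univ.filter fun e => σ e ≠ e).card : ℝ) / 4)) := by
  have hs : 0 < 1 - ρ ^ 2 := by nlinarith
  have hss : √(1 - ρ ^ 2) ^ 2 = 1 - ρ ^ 2 := Real.sq_sqrt hs.le
  set s := √(1 - ρ ^ 2) with hsdef
  rw [lintegral_prod _ (by fun_prop)]
  have key : ∀ x : ι → ℝ, ∫⁻ z, ENNReal.ofReal (Real.exp (phi ρ / 2 * ∑ e, x e *
        ((ρ * x (σ e) + s * z (σ e)) - (ρ * x e + s * z e))))
        ∂(Measure.pi fun _ : ι => gaussianReal 0 1)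
      = ENNReal.ofReal (Real.exp (-(ρ ^ 2 / (8 * (1 - ρ ^ 2)) * ∑ e, (x (σ e) - x e) ^ 2))) := by
    intro x
    have e1 : ∑ e, x e * (x (σ e) - x e) = -(1 / 2) * ∑ e, (x (σ e) - x e) ^ 2 := by
      have h2 : ∑ e, x (σ e) ^ 2 = ∑ e, x e ^ 2 := Equiv.sum_comp σ (fun e => x e ^ 2)
      have h3 : ∑ e, (x (σ e) - x e) ^ 2
          = ∑ e, x (σ e) ^ 2 - ∑ e, x e ^ 2 - 2 * ∑ e, x e * (x (σ e) - x e) := by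
        rw [Finset.mul_sum, ← Finset.sum_sub_distrib, ← Finset.sum_sub_distrib]
        exact Finset.sum_congr rfl fun e _ => by ring
      rw [h2] at h3
      linarith
    have e2 : ∀ z : ι → ℝ, ∑ e, x e * (z (σ e) - z e) = ∑ e, (x (σ.symm e) - x e) * z e := by
      intro z
      have h2 : ∑ e, x e * z (σ e) = ∑ e, x (σ.symm e) * z e := by
        rw [← Equiv.sum_comp σ (fun e => x (σ.symm e) * z e)]
        simp
      simp only [mul_sub, sub_mul, Finset.sum_sub_distrib]
      rw [h2]
    have e3 : ∑ e, (x (σ.symm e) - x e) ^ 2 = ∑ e, (x (σ e) - x e) ^ 2 := by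
      rw [← Equiv.sum_comp σ (fun e => (x (σ.symm e) - x e) ^ 2)]
      refine Finset.sum_congr rfl fun e _ => ?_
      rw [Equiv.symm_apply_apply]
      ring
    have e4 : ∀ z : ι → ℝ, ENNReal.ofReal (Real.exp (phi ρ / 2 * ∑ e, x e *
        ((ρ * x (σ e) + s * z (σ e)) - (ρ * x e + s * z e))))
        = ENNReal.ofReal (Real.exp (-(phi ρ * ρ / 4 * ∑ e, (x (σ e) - x e) ^ 2))) *
          ∏ e, ENNReal.ofReal (Real.exp ((phi ρ / 2 * s * (x (σ.symm e) - x e)) * z e)) := by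
      intro z
      rw [← ENNReal.ofReal_prod_of_nonneg (fun _ _ => (Real.exp_pos _).le), ← Real.exp_sum,
        ← ENNReal.ofReal_mul (Real.exp_pos _).le, ← Real.exp_add]
      congr 2
      have h5 : ∑ e, x e * ((ρ * x (σ e) + s * z (σ e)) - (ρ * x e + s * z e))
          = ρ * ∑ e, x e * (x (σ e) - x e) + s * ∑ e, x e * (z (σ e) - z e) := by
        rw [Finset.mul_sum, Finset.mul_sum, ← Finset.sum_add_distrib]
        exact Finset.sum_congr rfl fun e _ => by ring
      rw [h5, e1, e2]
      have h6 : ∑ e, phi ρ / 2 * s * (x (σ.symm e) - x e) * z e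
          = phi ρ / 2 * s * ∑ e, (x (σ.symm e) - x e) * z e := by
        rw [Finset.mul_sum]
        exact Finset.sum_congr rfl fun e _ => by ring
      rw [h6]
      ring
    simp_rw [e4]
    rw [lintegral_const_mul _ (by fun_prop),
      lint_prod (fun e w => ENNReal.ofReal (Real.exp ((phi ρ / 2 * s * (x (σ.symm e) - x e)) * w)))
      (fun e => by fun_prop)]
    simp_rw [lint_exp]
    rw [← ENNReal.ofReal_prod_of_nonneg (fun _ _ => (Real.exp_pos _).le), ← Real.exp_sum,
        ← ENNReal.ofReal_mul (Real.exp_pos _).le, ← Real.exp_add]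
    congr 2
    have h6 : ∑ e, (phi ρ / 2 * s * (x (σ.symm e) - x e)) ^ 2 / 2
        = phi ρ ^ 2 / 8 * (1 - ρ ^ 2) * ∑ e, (x (σ e) - x e) ^ 2 := by
      rw [← e3, Finset.mul_sum, ← hss]
      exact Finset.sum_congr rfl fun e _ => by ring
    rw [h6]
    unfold phi
    field_simp
    ring
  simp_rw [key]
  refine (spectral σ _ (by positivity)).trans (le_of_eq ?_)
  have h8 : 1 + 8 * (ρ ^ 2 / (8 * (1 - ρ ^ 2))) = (1 - ρ ^ 2)⁻¹ := by
    field_simp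
    ring
  rw [h8, Real.inv_rpow hs.le, Real.rpow_neg hs.le, inv_inv]

instance (ρ : ℝ) : IsProbabilityMeasure (gaussianPair ρ) :=
  Measure.isProbabilityMeasure_map (by fun_prop)

instance (d : ℕ) (r : ℝ) : IsProbabilityMeasure (featurePair d r) :=
  Measure.isProbabilityMeasure_map (by fun_prop)

lemma edge_bound {ι : Type*} [Fintype ι] [DecidableEq ι] (σ : Equiv.Perm ι) (ρ : ℝ)
    (h0 : 0 < ρ) (h1 : ρ < 1) :
    ∫⁻ ω, ENNReal.ofReal (Real.exp (phi ρ / 2 * ∑ e, (ω e).1 * ((ω (σ e)).2 - (ω e).2)))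
        ∂(Measure.pi fun _ : ι => gaussianPair ρ)
      ≤ ENNReal.ofReal ((1 - ρ ^ 2) ^
          (((Finset.univ.filter fun e => σ e ≠ e).card : ℝ) / 4)) := by
  refine le_trans (le_of_eq ?_) (two_stage σ ρ h0 h1)
  have hp : (Measure.pi fun _ : ι => gaussianPair ρ) = _ :=
    (Measure.pi_map_pi (μ := fun _ : ι => (gaussianReal 0 1).prod (gaussianReal 0 1))
      (f := fun _ z => (z.1, ρ * z.1 + Real.sqrt (1 - ρ ^ 2) * z.2))
      (hμ := fun _ => by
        have : IsProbabilityMeasure (gaussianPair ρ) := inferInstance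
        unfold gaussianPair at this
        infer_instance) (fun _ => by fun_prop)).symm
  rw [hp, lintegral_map (by fun_prop) (by fun_prop)]
  have hq := measurePreserving_arrowProdEquivProdArrow ℝ ℝ ι (fun _ => gaussianReal 0 1)
    (fun _ => gaussianReal 0 1)
  rw [← hq.lintegral_comp (by fun_prop)]
  rfl

lemma curry_mp (n d : ℕ) : MeasurePreserving (MeasurableEquiv.curry (Fin n) (Fin d) ℝ)
    (Measure.pi fun _ => gaussianReal 0 1)
    (Measure.pi fun _ => Measure.pi fun _ => gaussianReal 0 1) := by
  refine ⟨by fun_prop, ?_⟩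
  have := Measure.infinitePi_map_curry (fun (_ : Fin n) (_ : Fin d) => gaussianReal 0 1)
  simpa only [Measure.infinitePi_eq_pi] using this

lemma feature_bound {n : ℕ} (d : ℕ) (σ : Equiv.Perm (Fin n)) (r : ℝ)
    (h0 : 0 < r) (h1 : r < 1) :
    ∫⁻ ω, ENNReal.ofReal (Real.exp (phi r / 2 *
          ∑ v, ∑ i, (ω v).1 i * ((ω (σ v)).2 i - (ω v).2 i)))
        ∂(Measure.pi fun _ : Fin n => featurePair d r)
      ≤ ENNReal.ofReal ((1 - r ^ 2) ^
          (((Finset.univ.filter fun e => σ e ≠ e).card * d : ℝ) / 4)) := by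
  let τ : Equiv.Perm (Fin n × Fin d) := Equiv.prodCongr σ (Equiv.refl _)
  have hcard : ((Finset.univ.filter fun e => τ e ≠ e).card : ℝ)
      = (Finset.univ.filter fun e => σ e ≠ e).card * d := by
    have : (Finset.univ.filter fun e => τ e ≠ e)
        = (Finset.univ.filter fun e => σ e ≠ e) ×ˢ (Finset.univ : Finset (Fin d)) := by
      ext ⟨a, b⟩
      simp [τ]
    rw [this, Finset.card_product]
    simp
  rw [← hcard]
  refine le_trans (le_of_eq ?_) (two_stage τ r h0 h1)
  have hp : (Measure.pi fun _ : Fin n => featurePair d r) = _ :=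
    (Measure.pi_map_pi (μ := fun _ : Fin n => (Measure.pi fun _ : Fin d => gaussianReal 0 1).prod
      (Measure.pi fun _ : Fin d => gaussianReal 0 1))
      (f := fun _ z => (z.1, fun i => r * z.1 i + Real.sqrt (1 - r ^ 2) * z.2 i))
      (hμ := fun _ => by
        have : IsProbabilityMeasure (featurePair d r) := inferInstance
        unfold featurePair at this
        infer_instance) (fun _ => by fun_prop)).symm
  rw [hp, lintegral_map (by fun_prop) (by fun_prop)]
  have hq := measurePreserving_arrowProdEquivProdArrow (Fin d → ℝ) (Fin d → ℝ) (Fin n)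
    (fun _ => Measure.pi fun _ : Fin d => gaussianReal 0 1)
    (fun _ => Measure.pi fun _ : Fin d => gaussianReal 0 1)
  have hc := (curry_mp n d).prod (curry_mp n d)
  have hF : Measurable fun z : (Fin n → Fin d → ℝ) × (Fin n → Fin d → ℝ) =>
      ENNReal.ofReal (Real.exp (phi r / 2 * ∑ v, ∑ i, z.1 v i *
        ((r * z.1 (σ v) i + √(1 - r ^ 2) * z.2 (σ v) i)
          - (r * z.1 v i + √(1 - r ^ 2) * z.2 v i)))) := by fun_prop
  have a1 := hq.lintegral_comp hF
  have a2 := hc.lintegral_comp hF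
  refine Eq.trans ?_ ((a1.trans a2.symm).trans ?_)
  · rfl
  · refine lintegral_congr fun z => ?_
    simp only [Prod.map, Fintype.sum_prod_type]
    rfl

lemma edgeMap_mul {n : ℕ} (σ τ : Equiv.Perm (Fin n)) (e : Edge n) :
    edgeMap σ (edgeMap τ e) = edgeMap (σ * τ) e := by
  apply Subtype.ext
  simp only [edgeMap, Sym2.map_map]
  rfl

lemma edgeMap_one {n : ℕ} (e : Edge n) : edgeMap 1 e = e := by
  apply Subtype.ext
  simp [edgeMap]

/-- The permutation of edges induced by a vertex permutation. -/
def edgePerm {n : ℕ} (σ : Equiv.Perm (Fin n)) : Equiv.Perm (Edge n) where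
  toFun := edgeMap σ
  invFun := edgeMap σ⁻¹
  left_inv e := by rw [edgeMap_mul, inv_mul_cancel, edgeMap_one]
  right_inv e := by rw [edgeMap_mul, mul_inv_cancel, edgeMap_one]

lemma edge_count {n : ℕ} (σ : Equiv.Perm (Fin n)) (k : ℕ)
    (hk : (Finset.univ.filter fun v => σ v ≠ v).card = k) :
    2 * k * n ≤ 2 * (Finset.univ.filter fun e : Edge n => edgePerm σ e ≠ e).card
      + k * k + 2 * k := by
  classical
  set S := Finset.univ.filter fun v => σ v ≠ v with hS
  let T : Finset (Fin n × Fin n) := Finset.univ.filter fun p =>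
    p.1 ≠ p.2 ∧ s(σ p.1, σ p.2) ≠ s(p.1, p.2)
  let M := Finset.univ.filter fun e : Edge n => edgePerm σ e ≠ e
  have hT : T.card ≤ 2 * M.card := by
    let M' : Finset (Sym2 (Fin n)) := M.map (Function.Embedding.subtype _)
    have hM' : M'.card = M.card := Finset.card_map _
    rw [← hM']
    have hsub : T.image (fun p => s(p.1, p.2)) ⊆ M' := by
      intro e he
      simp only [Finset.mem_image, T, Finset.mem_filter, Finset.mem_univ, true_and] at he
      obtain ⟨p, ⟨h1, h2⟩, rfl⟩ := he
      simp only [M', M, Finset.mem_map, Finset.mem_filter, Finset.mem_univ, true_and]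
      refine ⟨⟨s(p.1, p.2), by simpa using h1⟩, ?_, rfl⟩
      intro h
      apply h2
      have := congrArg Subtype.val h
      simpa [edgePerm, edgeMap] using this
    refine (Finset.card_le_mul_card_image (f := fun p : Fin n × Fin n => s(p.1, p.2)) T 2 ?_).trans
      (Nat.mul_le_mul_left _ (Finset.card_le_card hsub))
    intro e _
    induction e using Sym2.ind with
    | _ x y =>
      refine (Finset.card_le_card (t := {(x, y), (y, x)}) ?_).trans Finset.card_le_two
      intro p hp
      simp only [Finset.mem_filter, Sym2.eq_iff] at hp
      simp only [Finset.mem_insert, Finset.mem_singleton, Prod.ext_iff]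
      exact hp.2
  let A : Finset (Fin n × Fin n) := S ×ˢ Finset.univ
  let B : Finset (Fin n × Fin n) := Finset.univ ×ˢ S
  have hAB : A ∩ B = S ×ˢ S := by
    ext p; simp [A, B]
  have hA : A.card = k * n := by simp [A, hk]
  have hB : B.card = n * k := by simp [B, hk]
  have hI : (A ∩ B).card = k * k := by rw [hAB, Finset.card_product, hk]
  have hcup : (A ∪ B).card + k * k = k * n + n * k := by
    rw [← hI, ← hA, ← hB, Finset.card_union_add_card_inter]
  have hsub : A ∪ B ⊆ T ∪ (S.image (fun v => (v, v)) ∪ S.image (fun v => (v, σ v))) := by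
    intro p hp
    obtain ⟨u, v⟩ := p
    simp only [A, B, S, Finset.mem_union, Finset.mem_product, Finset.mem_filter, Finset.mem_univ,
      true_and, and_true] at hp
    simp only [T, S, Finset.mem_union, Finset.mem_filter, Finset.mem_univ, true_and,
      Finset.mem_image, Prod.mk.injEq]
    by_cases huv : u = v
    · right; left
      subst huv
      exact ⟨u, by simpa using hp, rfl, rfl⟩
    · by_cases h : s(σ u, σ v) = s(u, v)
      · rw [Sym2.eq_iff] at h
        rcases h with ⟨h1, h2⟩ | ⟨h1, h2⟩
        · exact absurd hp (by simp [h1, h2])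
        · right; right
          exact ⟨u, by rw [h1]; exact fun h => huv h.symm, rfl, h1⟩
      · left
        exact ⟨huv, h⟩
  have h1 := Finset.card_le_card hsub
  have h2 := Finset.card_union_le T (S.image (fun v => (v, v)) ∪ S.image (fun v => (v, σ v)))
  have h3 := Finset.card_union_le (S.image (fun v => (v, v))) (S.image (fun v => (v, σ v)))
  have h4 : (S.image (fun v => (v, v))).card ≤ k := hk ▸ Finset.card_image_le
  have h5 : (S.image (fun v => (v, σ v))).card ≤ k := hk ▸ Finset.card_image_le
  change 2 * k * n ≤ 2 * M.card + k * k + 2 * k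
  nlinarith

lemma perm_count (n k : ℕ) :
    (Finset.univ.filter fun σ : Equiv.Perm (Fin n) =>
      (Finset.univ.filter fun v => σ v ≠ v).card = k).card ≤ n ^ k := by
  classical
  have hsub : (Finset.univ.filter fun σ : Equiv.Perm (Fin n) =>
      (Finset.univ.filter fun v => σ v ≠ v).card = k) ⊆
      (Finset.univ.powersetCard k).biUnion fun S : Finset (Fin n) =>
        Finset.univ.filter fun σ : Equiv.Perm (Fin n) => ∀ a, ¬ a ∈ S → σ a = a := by
    intro σ hσ
    simp only [Finset.mem_filter, Finset.mem_univ, true_and] at hσ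
    simp only [Finset.mem_biUnion, Finset.mem_powersetCard, Finset.mem_filter, Finset.mem_univ,
      true_and]
    refine ⟨_, ⟨Finset.subset_univ _, hσ⟩, ?_⟩
    intro a ha
    simpa using ha
  refine (Finset.card_le_card hsub).trans (Finset.card_biUnion_le.trans ?_)
  have hS : ∀ S ∈ Finset.univ.powersetCard k (α := Fin n),
      (Finset.univ.filter fun σ : Equiv.Perm (Fin n) => ∀ a, ¬ a ∈ S → σ a = a).card
        = k.factorial := by
    intro S hS
    rw [Finset.mem_powersetCard] at hS
    rw [← Fintype.card_subtype, ← Fintype.card_congr (Equiv.Perm.subtypeEquivSubtypePerm (· ∈ S)),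
      Fintype.card_perm]
    simp [hS.2]
  rw [Finset.sum_congr rfl hS, Finset.sum_const, Finset.card_powersetCard, Finset.card_univ,
    Fintype.card_fin, smul_eq_mul, mul_comm, ← Nat.descFactorial_eq_factorial_mul_choose]
  exact Nat.descFactorial_le_pow n k

lemma hamming_eq {n : ℕ} (π πs : Equiv.Perm (Fin n)) :
    hamming π πs = (Finset.univ.filter fun v => (πs⁻¹ * π) v ≠ v).card := by
  unfold hamming
  congr 1
  ext v
  simp only [Finset.mem_filter, Finset.mem_univ, true_and, Equiv.Perm.mul_apply, ne_eq,
    Equiv.Perm.inv_eq_iff_eq]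

lemma hamming_count {n : ℕ} (k : ℕ) (πs : Equiv.Perm (Fin n)) :
    (Finset.univ.filter fun π : Equiv.Perm (Fin n) => hamming π πs = k).card ≤ n ^ k := by
  refine le_trans ?_ (perm_count n k)
  refine Finset.card_le_card_of_injOn (fun π => πs⁻¹ * π) ?_ ?_
  · intro π hπ
    simp only [Finset.coe_filter, Finset.mem_univ, true_and, Set.mem_setOf_eq] at hπ ⊢
    rw [← hamming_eq, hπ]
  · intro a _ b _ h
    exact mul_left_cancel h

lemma measurable_obsOf {n d : ℕ} (πs : Equiv.Perm (Fin n)) :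
    Measurable (obsOf (d := d) πs) := by
  unfold obsOf
  fun_prop

lemma pair_bound {n d : ℕ} (ρ r : ℝ) (hρ : 0 < ρ ∧ ρ < 1) (hr : 0 < r ∧ r < 1)
    (π πs : Equiv.Perm (Fin n)) :
    obsLaw n d ρ r πs {o : Obs n d | score ρ r o πs ≤ score ρ r o π}
      ≤ ENNReal.ofReal ((1 - ρ ^ 2) ^
          (((Finset.univ.filter fun e => edgePerm (πs⁻¹ * π) e ≠ e).card : ℝ) / 4)) *
        ENNReal.ofReal ((1 - r ^ 2) ^
          (((Finset.univ.filter fun v => (πs⁻¹ * π) v ≠ v).card * d : ℝ) / 4)) := by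
  set σ := πs⁻¹ * π with hσ
  refine le_trans ?_ (mul_le_mul' (edge_bound (edgePerm σ) ρ hρ.1 hρ.2)
    (feature_bound d σ r hr.1 hr.2))
  rw [← lintegral_prod_mul (by fun_prop) (by fun_prop)]
  have hms : ∀ π, Measurable fun o : Obs n d => score ρ r o π := by
    intro π
    unfold score
    fun_prop
  unfold obsLaw
  rw [Measure.map_apply (measurable_obsOf πs) (measurableSet_le (hms _) (hms _))]
  set A := obsOf (d := d) πs ⁻¹' {o : Obs n d | score ρ r o πs ≤ score ρ r o π} with hA
  have hAm : MeasurableSet A :=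
    measurable_obsOf πs (measurableSet_le (hms _) (hms _))
  have h1 : sample n d ρ r A = ∫⁻ ω, A.indicator 1 ω ∂(sample n d ρ r) := by
    rw [lintegral_indicator_one hAm]
  rw [h1]
  refine lintegral_mono fun ω => ?_
  by_cases hω : ω ∈ A
  · rw [Set.indicator_of_mem hω, Pi.one_apply, ← ENNReal.ofReal_mul (Real.exp_pos _).le,
      ← Real.exp_add, ← ENNReal.ofReal_one]
    refine ENNReal.ofReal_le_ofReal (Real.one_le_exp ?_)
    have hω' : score ρ r (obsOf πs ω) πs ≤ score ρ r (obsOf πs ω) π := hω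
    have hs : ∀ π', score ρ r (obsOf πs ω) π' =
        phi ρ * ∑ e, (ω.1 e).1 * (ω.1 (edgePerm (πs⁻¹ * π') e)).2
        + phi r * ∑ v, ∑ i, (ω.2 v).1 i * (ω.2 ((πs⁻¹ * π') v)).2 i := by
      intro π'
      simp only [score, obsOf, edgeMap_mul]
      rfl
    rw [hs, hs, inv_mul_cancel, ← hσ] at hω'
    have he1 : ∀ e : Edge n, edgePerm 1 e = e := fun e => edgeMap_one e
    simp only [he1, Equiv.Perm.one_apply] at hω'
    simp only [mul_sub, Finset.sum_sub_distrib]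
    linarith
  · rw [Set.indicator_of_notMem hω]
    exact zero_le

/-- Proposition: error bound for small Hamming distance. Under
the featured correlated Gaussian Wigner model, if
`n log(1/(1-ρ²)) + d log(1/(1-r²)) ≥ (4+ε) log n` with `0 < ε < 1`, then for all
sufficiently large `n` and every `k` with `1 ≤ k ≤ ε n / 16`, the MLE `π̂`
satisfies `P[d(π̂, π*) = k] ≤ exp(-(ε/8) k log n)`. -/
theorem mle_error_bound_small_k
    (d : ℕ → ℕ) (ρ r : ℕ → ℝ) (ε : ℝ)
    (hρ : ∀ n, 0 < ρ n ∧ ρ n < 1) (hr : ∀ n, 0 < r n ∧ r n < 1)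
    (hε : 0 < ε) (hε1 : ε < 1)
    (hthr : ∀ n : ℕ, (4 + ε) * Real.log n ≤
      (n : ℝ) * Real.log (1 / (1 - ρ n ^ 2)) + (d n : ℝ) * Real.log (1 / (1 - r n ^ 2))) :
    ∃ N : ℕ, ∀ n, N ≤ n →
      ∀ k : ℕ, 1 ≤ k → (k : ℝ) ≤ ε * n / 16 →
      ∀ πs : Equiv.Perm (Fin n),
      ∀ mle : Obs n (d n) → Equiv.Perm (Fin n),
        (∀ o π', score (ρ n) (r n) o π' ≤ score (ρ n) (r n) o (mle o)) →
        obsLaw n (d n) (ρ n) (r n) πs {o : Obs n (d n) | hamming (mle o) πs = k}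
          ≤ ENNReal.ofReal (Real.exp (-(ε / 8 * k * Real.log n))) := by
  refine ⟨⌈32 / ε⌉₊ + 1, fun n hn k hk1 hk πs mle hmle => ?_⟩
  obtain ⟨hρ0, hρ1⟩ := hρ n
  obtain ⟨hr0, hr1⟩ := hr n
  have hnε : 32 ≤ ε * n := by
    have h1 : 32 / ε ≤ (n : ℝ) := (Nat.le_ceil _).trans (by exact_mod_cast (by omega))
    rw [div_le_iff₀ hε] at h1
    linarith
  have hn1 : 1 ≤ n := by omega
  have hn1' : (1 : ℝ) ≤ n := by exact_mod_cast hn1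
  have hL : 0 ≤ Real.log n := Real.log_nonneg hn1'
  have hsρ : 0 < 1 - ρ n ^ 2 := by nlinarith
  have hsr : 0 < 1 - r n ^ 2 := by nlinarith
  have hthr' := hthr n
  rw [one_div, one_div, Real.log_inv, Real.log_inv] at hthr'
  have ha : Real.log (1 - ρ n ^ 2) ≤ 0 := Real.log_nonpos hsρ.le (by nlinarith)
  have hb : Real.log (1 - r n ^ 2) ≤ 0 := Real.log_nonpos hsr.le (by nlinarith)
  have hk0 : (0 : ℝ) ≤ k := by positivity
  have hpair : ∀ π ∈ Finset.univ.filter fun π : Equiv.Perm (Fin n) => hamming π πs = k,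
      obsLaw n (d n) (ρ n) (r n) πs
        {o : Obs n (d n) | score (ρ n) (r n) o πs ≤ score (ρ n) (r n) o π}
      ≤ ENNReal.ofReal (Real.exp (-((1 + ε / 8) * k * Real.log n))) := by
    intro π hπ
    simp only [Finset.mem_filter, Finset.mem_univ, true_and] at hπ
    rw [hamming_eq] at hπ
    refine (pair_bound (ρ n) (r n) (hρ n) (hr n) π πs).trans ?_
    have hc := edge_count _ k hπ
    rw [hπ]
    set M := (Finset.univ.filter fun e : Edge n => edgePerm (πs⁻¹ * π) e ≠ e).card
    have hc' : 2 * (k : ℝ) * n ≤ 2 * M + k * k + 2 * k := by exact_mod_cast hc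
    rw [← ENNReal.ofReal_mul (Real.rpow_nonneg hsρ.le _), Real.rpow_def_of_pos hsρ,
      Real.rpow_def_of_pos hsr, ← Real.exp_add]
    refine ENNReal.ofReal_le_ofReal (Real.exp_le_exp.mpr ?_)
    have hM : (1 - ε / 16) * (k * n) ≤ (M : ℝ) := by nlinarith
    set a := -Real.log (1 - ρ n ^ 2) with haa
    set b := -Real.log (1 - r n ^ 2) with hbb
    have ea : Real.log (1 - ρ n ^ 2) = -a := by simp [haa]
    have eb : Real.log (1 - r n ^ 2) = -b := by simp [hbb]
    rw [ea, eb]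
    have ha' : 0 ≤ a := by linarith
    have hb' : 0 ≤ b := by linarith
    have h1 : a * ((1 - ε / 16) * (k * n)) ≤ a * M := mul_le_mul_of_nonneg_left hM ha'
    have h2 : (1 - ε / 16) * (b * k * d n) ≤ b * k * d n := by
      have : 0 ≤ b * k * d n := by positivity
      nlinarith
    have h3 : (1 - ε / 16) * k * ((4 + ε) * Real.log n) ≤ (1 - ε / 16) * k * (n * a + d n * b) :=
      mul_le_mul_of_nonneg_left hthr' (mul_nonneg (by linarith) hk0)
    have h4 : (4 + ε / 2) * (k * Real.log n) ≤ (1 - ε / 16) * (4 + ε) * (k * Real.log n) :=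
      mul_le_mul_of_nonneg_right (by nlinarith) (mul_nonneg hk0 hL)
    nlinarith
  have hsub : {o : Obs n (d n) | hamming (mle o) πs = k} ⊆
      ⋃ π ∈ Finset.univ.filter fun π : Equiv.Perm (Fin n) => hamming π πs = k,
        {o : Obs n (d n) | score (ρ n) (r n) o πs ≤ score (ρ n) (r n) o π} := by
    intro o ho
    simp only [Set.mem_iUnion]
    exact ⟨mle o, by simpa using ho, hmle o πs⟩
  refine (measure_mono hsub).trans ((measure_biUnion_finset_le _ _).trans
    ((Finset.sum_le_sum hpair).trans ?_))
  rw [Finset.sum_const, nsmul_eq_mul]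
  have hcard : ((Finset.univ.filter fun π : Equiv.Perm (Fin n) => hamming π πs = k).card : ℝ≥0∞)
      ≤ ENNReal.ofReal (Real.exp (k * Real.log n)) := by
    have h1 : Real.exp (k * Real.log n) = ((n ^ k : ℕ) : ℝ) := by
      rw [mul_comm, Real.exp_mul, Real.exp_log (by linarith), Real.rpow_natCast]
      push_cast
      rfl
    rw [h1, ENNReal.ofReal_natCast]
    exact_mod_cast hamming_count k πs
  refine (mul_le_mul_left hcard _).trans (le_of_eq ?_)
  rw [← ENNReal.ofReal_mul (Real.exp_pos _).le, ← Real.exp_add]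
  congr 2
  ring

end FCGW
end

section
/- Under the featured correlated Gaussian Wigner model G(n,d,ρ,r) with π* uniformly distributed over S_n, suppose r² ≥ 40/d and n·log(1/(1−ρ²)) + d·log(1/(1−r²)) + 4·log d ≤ (4−ε)·log n for some constant ε > 0. Then for any estimator π̂ = π̂(G1,G2), P[π̂ ≠ π*] = 1 − o(1) as n → ∞; that is, exact recovery is impossible. -/
open MeasureTheory ProbabilityTheory Filter
open scoped ENNReal

namespace FCGW

lemma gauss_lint (α β γ : ℝ) (h : 0 < 1 + 2 * α) :
    ∫⁻ z, ENNReal.ofReal (Real.exp (-α * z ^ 2 + β * z + γ)) ∂(gaussianReal 0 1)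
      = ENNReal.ofReal ((√(1 + 2 * α))⁻¹ * Real.exp (γ + β ^ 2 / (2 * (1 + 2 * α)))) := by
  set v : NNReal := ⟨(1 + 2 * α)⁻¹, by positivity⟩ with hv
  have hv0 : v ≠ 0 := by
    intro h0
    have : (v : ℝ) = 0 := by rw [h0]; rfl
    rw [hv] at this
    have h2 : (1 + 2 * α)⁻¹ = 0 := this
    exact (inv_pos.mpr h).ne' h2
  have key : ∀ z, gaussianPDF 0 1 z * ENNReal.ofReal (Real.exp (-α * z ^ 2 + β * z + γ))
      = ENNReal.ofReal ((√(1 + 2 * α))⁻¹ * Real.exp (γ + β ^ 2 / (2 * (1 + 2 * α))))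
        * gaussianPDF (β / (1 + 2 * α)) v z := by
    intro z
    rw [gaussianPDF, gaussianPDF, ← ENNReal.ofReal_mul (gaussianPDFReal_nonneg _ _ _),
      ← ENNReal.ofReal_mul (by positivity)]
    congr 1
    rw [gaussianPDFReal, gaussianPDFReal]
    have hvv : (v : ℝ) = (1 + 2 * α)⁻¹ := rfl
    rw [hvv]
    have e1 : √(2 * Real.pi * (1 + 2 * α)⁻¹) = √(2 * Real.pi) * (√(1 + 2 * α))⁻¹ := by
      rw [Real.sqrt_mul (by positivity), Real.sqrt_inv]
    rw [e1]
    have hs : 0 < √(1 + 2 * α) := Real.sqrt_pos.mpr h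
    have hp : 0 < √(2 * Real.pi) := Real.sqrt_pos.mpr (by positivity)
    simp only [NNReal.coe_one, mul_one, sub_zero]
    rw [mul_assoc, ← Real.exp_add]
    have : (√(1 + 2 * α))⁻¹ * Real.exp (γ + β ^ 2 / (2 * (1 + 2 * α))) *
        ((√(2 * Real.pi) * (√(1 + 2 * α))⁻¹)⁻¹ *
          Real.exp (-(z - β / (1 + 2 * α)) ^ 2 / (2 * (1 + 2 * α)⁻¹)))
        = (√(2 * Real.pi))⁻¹ * (Real.exp (γ + β ^ 2 / (2 * (1 + 2 * α))) *
          Real.exp (-(z - β / (1 + 2 * α)) ^ 2 / (2 * (1 + 2 * α)⁻¹))) := by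
      field_simp
    rw [this, ← Real.exp_add]
    congr 2
    field_simp
    ring
  rw [gaussianReal_of_var_ne_zero _ one_ne_zero,
    lintegral_withDensity_eq_lintegral_mul _ (measurable_gaussianPDF _ _) (by fun_prop)]
  simp only [Pi.mul_apply, key]
  rw [lintegral_const_mul _ (measurable_gaussianPDF _ _), lintegral_gaussianPDF_eq_one _ hv0, mul_one]

lemma gauss_lint' (α β γ : ℝ) (h : 0 < 1 + 2 * α) (f : ℝ → ℝ)
    (hf : ∀ z, f z = -α * z ^ 2 + β * z + γ) (C : ℝ) (hC : 0 ≤ C) :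
    ∫⁻ z, ENNReal.ofReal (C * Real.exp (f z)) ∂(gaussianReal 0 1)
      = ENNReal.ofReal (C * (√(1 + 2 * α))⁻¹ * Real.exp (γ + β ^ 2 / (2 * (1 + 2 * α)))) := by
  simp_rw [hf, ENNReal.ofReal_mul hC]
  rw [lintegral_const_mul _ (by fun_prop), gauss_lint _ _ _ h, ← ENNReal.ofReal_mul hC, mul_assoc]

instance (c : ℝ) : IsProbabilityMeasure (gaussianPair c) := by
  unfold gaussianPair
  exact Measure.isProbabilityMeasure_map (by fun_prop)

lemma lint_pair (c : ℝ) (f : ℝ × ℝ → ℝ≥0∞) (hf : Measurable f) :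
    ∫⁻ p, f p ∂(gaussianPair c) = ∫⁻ z, ∫⁻ w, f (z, c * z + √(1 - c ^ 2) * w)
      ∂(gaussianReal 0 1) ∂(gaussianReal 0 1) := by
  unfold gaussianPair
  rw [lintegral_map hf (by fun_prop), lintegral_prod _ (by fun_prop)]

/-- two-vertex block mgf -/
noncomputable def F2 (c t : ℝ) : ℝ := (√((1 - c ^ 2 * (1 - 2 * t) ^ 2) / (1 - c ^ 2)))⁻¹

noncomputable def F3 (c : ℝ) : ℝ := (1 - c ^ 2) / (1 - c ^ 2 / 4)

lemma alg1 (A z : ℝ) (h : 1 + 2 * A ≠ 0) :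
    -A * z ^ 2 + (2 * A * z) ^ 2 / (2 * (1 + 2 * A)) = -(A / (1 + 2 * A)) * z ^ 2 + 0 * z + 0 := by
  obtain ⟨B, hB⟩ : ∃ B, B = 1 + 2 * A := ⟨_, rfl⟩
  have hA : A = (B - 1) / 2 := by linarith
  rw [← hB] at h ⊢
  rw [hA]
  field_simp
  ring

lemma block2 (c t : ℝ) (hc : c ^ 2 < 1) (ht : c ^ 2 * (1 - 2 * t) ^ 2 < 1) :
    ∫⁻ x : Fin 2 → ℝ × ℝ, ENNReal.ofReal (Real.exp
      (-t * (phi c * (((x 0).1 - (x 1).1) * ((x 0).2 - (x 1).2)))))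
      ∂(Measure.pi fun _ => gaussianPair c) = ENNReal.ofReal (F2 c t) := by
  have h1 : 0 < 1 - c ^ 2 := by linarith
  have hs : √(1 - c ^ 2) ^ 2 = 1 - c ^ 2 := Real.sq_sqrt h1.le
  set s := √(1 - c ^ 2) with hsd
  set κ := c ^ 2 / (1 - c ^ 2) with hκ
  have hpc : phi c * c = κ := by unfold phi; rw [hκ]; field_simp
  have hps : phi c ^ 2 * s ^ 2 = κ := by unfold phi; rw [hκ, hs]; field_simp
  have e4 : (1 - c ^ 2 * (1 - 2 * t) ^ 2) / (1 - c ^ 2) = 1 + 4 * (κ * (t - t ^ 2)) := by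
    rw [hκ]; field_simp; ring
  have p4 : 0 < 1 + 4 * (κ * (t - t ^ 2)) := by
    rw [← e4]; apply div_pos <;> linarith
  have p2 : 0 < 1 + 2 * (κ * (t - t ^ 2)) := by linarith
  have hmp := (measurePreserving_finTwoArrow (gaussianPair c)).symm
  rw [← hmp.lintegral_comp_emb (MeasurableEquiv.measurableEmbedding _)]
  rw [lintegral_prod _ (by fun_prop)]
  change ∫⁻ x : ℝ × ℝ, ∫⁻ y : ℝ × ℝ, ENNReal.ofReal (Real.exp
    (-t * (phi c * ((x.1 - y.1) * (x.2 - y.2))))) ∂(gaussianPair c) ∂(gaussianPair c) = _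
  rw [lint_pair _ _ (by fun_prop)]
  set φ := phi c
  have step1 : ∀ z w : ℝ, (∫⁻ y : ℝ × ℝ, ENNReal.ofReal (Real.exp
      (-t * (φ * ((z - y.1) * (c * z + s * w - y.2))))) ∂(gaussianPair c))
      = ∫⁻ z' , ENNReal.ofReal (Real.exp (-t * φ * (z - z') * (c * (z - z') + s * w)
          + (t * φ * s * (z - z')) ^ 2 / 2)) ∂(gaussianReal 0 1) := by
    intro z w
    rw [lint_pair _ _ (by fun_prop)]
    refine lintegral_congr fun z' => ?_
    have := gauss_lint' 0 (t * φ * s * (z - z')) (-t * φ * (z - z') * (c * (z - z') + s * w))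
      (by norm_num) (fun w' => -t * (φ * ((z - z') * (c * z + s * w - (c * z' + s * w')))))
      (fun w' => by ring) 1 zero_le_one
    simp only [one_mul] at this
    rw [this]
    congr 1
    norm_num
  have step2 : ∀ z : ℝ, (∫⁻ w, ∫⁻ z' , ENNReal.ofReal (Real.exp (-t * φ * (z - z') * (c * (z - z') + s * w)
          + (t * φ * s * (z - z')) ^ 2 / 2)) ∂(gaussianReal 0 1) ∂(gaussianReal 0 1))
      = ∫⁻ z' , ENNReal.ofReal (Real.exp (-(κ * (t - t ^ 2)) * (z - z') ^ 2)) ∂(gaussianReal 0 1) := by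
    intro z
    rw [lintegral_lintegral_swap (by fun_prop)]
    refine lintegral_congr fun z' => ?_
    have := gauss_lint' 0 (-t * φ * s * (z - z')) (-t * φ * (z - z') * (c * (z - z'))
          + (t * φ * s * (z - z')) ^ 2 / 2)
      (by norm_num) (fun w => -t * φ * (z - z') * (c * (z - z') + s * w)
          + (t * φ * s * (z - z')) ^ 2 / 2)
      (fun w' => by ring) 1 zero_le_one
    simp only [one_mul] at this
    rw [this]
    congr 1
    norm_num
    linear_combination (- t * (z - z') ^ 2) * hpc + (t ^ 2 * (z - z') ^ 2) * hps
  refine (lintegral_congr fun z => (lintegral_congr fun w => step1 z w).trans (step2 z)).trans ?_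
  set A := κ * (t - t ^ 2) with hA
  have step3 : ∀ z : ℝ, (∫⁻ z' , ENNReal.ofReal (Real.exp (-A * (z - z') ^ 2)) ∂(gaussianReal 0 1))
      = ENNReal.ofReal ((√(1 + 2 * A))⁻¹ * Real.exp (-(A / (1 + 2 * A)) * z ^ 2 + 0 * z + 0)) := by
    intro z
    have := gauss_lint' A (2 * A * z) (-A * z ^ 2) p2 (fun z' => -A * (z - z') ^ 2)
      (fun w' => by ring) 1 zero_le_one
    simp only [one_mul] at this
    rw [this]
    congr 3
    have := p2.ne'
    exact alg1 A z this
  simp_rw [step3]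
  have p3 : 1 + 2 * (A / (1 + 2 * A)) = (1 + 4 * A) / (1 + 2 * A) := by field_simp; ring
  rw [gauss_lint' (A / (1 + 2 * A)) 0 0 (by rw [p3]; positivity) _ (fun z => rfl) _ (by positivity), p3,
    Real.sqrt_div p4.le, F2, e4]
  have : 0 < √(1 + 2 * A) := Real.sqrt_pos.mpr p2
  congr 1
  norm_num
  field_simp

lemma block3 (c : ℝ) (hc : c ^ 2 < 1) :
    ∫⁻ x : Fin 3 → ℝ × ℝ, ENNReal.ofReal (Real.exp
      (-(1 / 2) * (phi c * (((x 0).1 - (x 1).1) * ((x 0).2 - (x 1).2))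
         + phi c * (((x 0).1 - (x 2).1) * ((x 0).2 - (x 2).2)))))
      ∂(Measure.pi fun _ => gaussianPair c) = ENNReal.ofReal (F3 c) := by
  have h1 : 0 < 1 - c ^ 2 := by linarith
  have hs : √(1 - c ^ 2) ^ 2 = 1 - c ^ 2 := Real.sq_sqrt h1.le
  set s := √(1 - c ^ 2) with hsd
  set κ := c ^ 2 / (1 - c ^ 2) with hκ
  have hκ0 : 0 ≤ κ := by positivity
  have hpc : phi c * c = κ := by unfold phi; rw [hκ]; field_simp
  have hps : phi c ^ 2 * s ^ 2 = κ := by unfold phi; rw [hκ, hs]; field_simp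
  have hmp := (measurePreserving_piFinSuccAbove (fun _ : Fin 3 => gaussianPair c) 0).symm
  rw [← hmp.lintegral_comp_emb (MeasurableEquiv.measurableEmbedding _)]
  rw [lintegral_prod _ (by fun_prop)]
  have hmp2 := (measurePreserving_finTwoArrow (gaussianPair c)).symm
  have step0 : ∀ x : ℝ × ℝ, (∫⁻ y : Fin 2 → ℝ × ℝ, ENNReal.ofReal (Real.exp
      (-(1 / 2) * (phi c * ((x.1 - (y 0).1) * (x.2 - (y 0).2))
         + phi c * ((x.1 - (y 1).1) * (x.2 - (y 1).2)))))
      ∂(Measure.pi fun _ => gaussianPair c))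
      = ∫⁻ y : ℝ × ℝ, ∫⁻ y' : ℝ × ℝ, ENNReal.ofReal (Real.exp
      (-(1 / 2) * (phi c * ((x.1 - y.1) * (x.2 - y.2))
         + phi c * ((x.1 - y'.1) * (x.2 - y'.2))))) ∂(gaussianPair c) ∂(gaussianPair c) := by
    intro x
    rw [← hmp2.lintegral_comp_emb (MeasurableEquiv.measurableEmbedding _)]
    rw [lintegral_prod _ (by fun_prop)]
    rfl
  refine (lintegral_congr fun x => step0 x).trans ?_
  set φ := phi c
  rw [lint_pair _ _ (by fun_prop)]
  -- single other vertex
  have one : ∀ z b : ℝ, (∫⁻ y : ℝ × ℝ, ENNReal.ofReal (Real.exp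
      (-(1 / 2) * (φ * ((z - y.1) * (b - y.2))))) ∂(gaussianPair c))
      = ∫⁻ z', ENNReal.ofReal (Real.exp (-(1 / 2) * φ * (z - z') * (b - c * z')
          + κ * (z - z') ^ 2 / 8)) ∂(gaussianReal 0 1) := by
    intro z b
    rw [lint_pair _ _ (by fun_prop)]
    refine lintegral_congr fun z' => ?_
    have := gauss_lint' 0 (1 / 2 * φ * s * (z - z')) (-(1 / 2) * φ * (z - z') * (b - c * z'))
      (by norm_num) (fun w' => -(1 / 2) * (φ * ((z - z') * (b - (c * z' + s * w')))))
      (fun w' => by ring) 1 zero_le_one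
    simp only [one_mul] at this
    rw [this]
    congr 1
    norm_num
    linear_combination ((z - z') ^ 2 / 8) * hps
  have two : ∀ x : ℝ × ℝ, (∫⁻ y : ℝ × ℝ, ∫⁻ y' : ℝ × ℝ, ENNReal.ofReal (Real.exp
      (-(1 / 2) * (φ * ((x.1 - y.1) * (x.2 - y.2))
         + φ * ((x.1 - y'.1) * (x.2 - y'.2))))) ∂(gaussianPair c) ∂(gaussianPair c))
      = ∫⁻ z₁, ∫⁻ z₂, ENNReal.ofReal (Real.exp (-(1 / 2) * φ * (x.1 - z₁) * (x.2 - c * z₁)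
          + κ * (x.1 - z₁) ^ 2 / 8 + (-(1 / 2) * φ * (x.1 - z₂) * (x.2 - c * z₂)
          + κ * (x.1 - z₂) ^ 2 / 8))) ∂(gaussianReal 0 1) ∂(gaussianReal 0 1) := by
    intro x
    simp_rw [mul_add, Real.exp_add _ , ENNReal.ofReal_mul (Real.exp_nonneg _)]
    simp_rw [← ENNReal.ofReal_mul (Real.exp_nonneg _), ← Real.exp_add]
    have e : ∀ y y' : ℝ × ℝ, ENNReal.ofReal (Real.exp
      (-(1 / 2) * (φ * ((x.1 - y.1) * (x.2 - y.2)))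
         + -(1 / 2) * (φ * ((x.1 - y'.1) * (x.2 - y'.2)))))
        = ENNReal.ofReal (Real.exp (-(1 / 2) * (φ * ((x.1 - y.1) * (x.2 - y.2))))) *
         ENNReal.ofReal (Real.exp (-(1 / 2) * (φ * ((x.1 - y'.1) * (x.2 - y'.2))))) := by
      intro y y'
      rw [Real.exp_add, ENNReal.ofReal_mul (Real.exp_nonneg _)]
    have e' : ∀ z₁ z₂ : ℝ, ENNReal.ofReal (Real.exp (-(1 / 2) * φ * (x.1 - z₁) * (x.2 - c * z₁)
          + κ * (x.1 - z₁) ^ 2 / 8 + (-(1 / 2) * φ * (x.1 - z₂) * (x.2 - c * z₂)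
          + κ * (x.1 - z₂) ^ 2 / 8)))
        = ENNReal.ofReal (Real.exp (-(1 / 2) * φ * (x.1 - z₁) * (x.2 - c * z₁)
          + κ * (x.1 - z₁) ^ 2 / 8)) * ENNReal.ofReal (Real.exp (-(1 / 2) * φ * (x.1 - z₂) * (x.2 - c * z₂)
          + κ * (x.1 - z₂) ^ 2 / 8)) := by
      intro y y'
      rw [Real.exp_add (_ + _), ENNReal.ofReal_mul (Real.exp_nonneg _)]
    simp_rw [e, e']
    simp_rw [lintegral_const_mul' _ _ ENNReal.ofReal_ne_top]
    rw [lintegral_mul_const _ (by fun_prop), lintegral_mul_const _ (by fun_prop), one]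
  -- integrate w
  have step3 : ∀ z : ℝ, (∫⁻ w, ∫⁻ z₁, ∫⁻ z₂, ENNReal.ofReal (Real.exp (-(1 / 2) * φ * (z - z₁) * (c * z + s * w - c * z₁)
          + κ * (z - z₁) ^ 2 / 8 + (-(1 / 2) * φ * (z - z₂) * (c * z + s * w - c * z₂)
          + κ * (z - z₂) ^ 2 / 8))) ∂(gaussianReal 0 1) ∂(gaussianReal 0 1) ∂(gaussianReal 0 1))
      = ∫⁻ z₁, ∫⁻ z₂, ENNReal.ofReal (Real.exp (-(κ / 4) * ((z - z₁) ^ 2 + (z - z₂) ^ 2 - (z - z₁) * (z - z₂))))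
         ∂(gaussianReal 0 1) ∂(gaussianReal 0 1) := by
    intro z
    rw [lintegral_lintegral_swap (by fun_prop)]
    refine lintegral_congr fun z₁ => ?_
    rw [lintegral_lintegral_swap (by fun_prop)]
    refine lintegral_congr fun z₂ => ?_
    have := gauss_lint' 0 (-(1 / 2) * φ * s * ((z - z₁) + (z - z₂)))
      (-(1 / 2) * φ * c * ((z - z₁) ^ 2 + (z - z₂) ^ 2) + κ * ((z - z₁) ^ 2 + (z - z₂) ^ 2) / 8)
      (by norm_num) (fun w => -(1 / 2) * φ * (z - z₁) * (c * z + s * w - c * z₁)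
          + κ * (z - z₁) ^ 2 / 8 + (-(1 / 2) * φ * (z - z₂) * (c * z + s * w - c * z₂)
          + κ * (z - z₂) ^ 2 / 8))
      (fun w' => by ring) 1 zero_le_one
    simp only [one_mul] at this
    rw [this]
    congr 1
    norm_num
    linear_combination (-(1 / 2) * ((z - z₁) ^ 2 + (z - z₂) ^ 2)) * hpc
      + (((z - z₁) + (z - z₂)) ^ 2 / 8) * hps
  refine (lintegral_congr fun z => (lintegral_congr fun w => two (z, c * z + s * w)).trans (step3 z)).trans ?_
  rw [lintegral_lintegral_swap (by fun_prop)]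
  have step4 : ∀ z₁ : ℝ, (∫⁻ z, ∫⁻ z₂, ENNReal.ofReal (Real.exp (-(κ / 4) * ((z - z₁) ^ 2 + (z - z₂) ^ 2 - (z - z₁) * (z - z₂))))
         ∂(gaussianReal 0 1) ∂(gaussianReal 0 1))
      = ∫⁻ z₂, ENNReal.ofReal ((√(1 + κ / 2))⁻¹ * Real.exp
          (-(κ / 4) * (z₁ ^ 2 + z₂ ^ 2 - z₁ * z₂) + (κ / 4 * (z₁ + z₂)) ^ 2 / (2 * (1 + κ / 2))))
         ∂(gaussianReal 0 1) := by
    intro z₁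
    rw [lintegral_lintegral_swap (by fun_prop)]
    refine lintegral_congr fun z₂ => ?_
    have := gauss_lint' (κ / 4) (κ / 4 * (z₁ + z₂)) (-(κ / 4) * (z₁ ^ 2 + z₂ ^ 2 - z₁ * z₂))
      (by positivity) (fun z => -(κ / 4) * ((z - z₁) ^ 2 + (z - z₂) ^ 2 - (z - z₁) * (z - z₂)))
      (fun w' => by ring) 1 zero_le_one
    simp only [one_mul] at this
    rw [this]
    have : 1 + 2 * (κ / 4) = 1 + κ / 2 := by ring
    rw [this]
  simp_rw [step4]
  set N := 1 + κ / 2 with hN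
  have hNp : 0 < N := by positivity
  -- coefficients: A z₂² + B z₁ z₂ + A z₁², A = κ/4 - κ²/(32 N), B = κ/4 + κ²/(16N)
  set A := κ / 4 - κ ^ 2 / (32 * N) with hA
  set B := κ / 4 + κ ^ 2 / (16 * N) with hB
  have hAp : 0 < 1 + 2 * A := by
    have : κ ^ 2 / (32 * N) ≤ κ / 4 := by
      rw [div_le_iff₀ (by positivity), hN]; nlinarith
    linarith
  have step5 : ∀ z₁ : ℝ, (∫⁻ z₂, ENNReal.ofReal ((√N)⁻¹ * Real.exp
          (-(κ / 4) * (z₁ ^ 2 + z₂ ^ 2 - z₁ * z₂) + (κ / 4 * (z₁ + z₂)) ^ 2 / (2 * N)))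
         ∂(gaussianReal 0 1))
      = ENNReal.ofReal ((√N)⁻¹ * (√(1 + 2 * A))⁻¹ * Real.exp
          (-(A - B ^ 2 / (2 * (1 + 2 * A))) * z₁ ^ 2 + 0 * z₁ + 0)) := by
    intro z₁
    rw [gauss_lint' A (B * z₁) (-A * z₁ ^ 2) hAp _ _ _ (by positivity)]
    · congr 3; ring
    · intro z₂; rw [hA, hB]; field_simp; ring
  simp_rw [step5]
  have q1 : N * (1 + 2 * A) = 1 + κ + 3 / 16 * κ ^ 2 := by rw [hA]; field_simp; rw [hN]; ring
  have q2 : (N * (1 + 2 * A)) * (1 + 2 * (A - B ^ 2 / (2 * (1 + 2 * A)))) = (1 + 3 / 4 * κ) ^ 2 := by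
    have : (N * (1 + 2 * A)) * (1 + 2 * (A - B ^ 2 / (2 * (1 + 2 * A))))
       = N * ((1 + 2 * A) ^ 2 - B ^ 2) := by field_simp; ring
    rw [this, hA, hB]; field_simp; rw [hN]; ring
  have q3 : 0 < 1 + 2 * (A - B ^ 2 / (2 * (1 + 2 * A))) := by
    have h5 : 0 < N * (1 + 2 * A) := by positivity
    by_contra hcon
    have : (N * (1 + 2 * A)) * (1 + 2 * (A - B ^ 2 / (2 * (1 + 2 * A)))) ≤ 0 :=
      mul_nonpos_of_nonneg_of_nonpos h5.le (not_lt.mp hcon)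
    rw [q2] at this
    have : 0 < (1 + 3 / 4 * κ) ^ 2 := by positivity
    linarith
  rw [gauss_lint' _ 0 0 q3 _ (fun z => rfl) _ (by positivity)]
  congr 1
  rw [← Real.sqrt_inv, ← Real.sqrt_inv, ← Real.sqrt_inv, ← Real.sqrt_mul (by positivity),
    ← Real.sqrt_mul (by positivity), ← mul_inv, ← mul_inv, q2, Real.sqrt_inv, Real.sqrt_sq (by positivity)]
  rw [F3, hκ]
  norm_num
  have : 0 < 1 - c ^ 2 / 4 := by nlinarith
  have h6 : 0 < 4 - c ^ 2 := by linarith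
  field_simp
  ring



section piLemmas
variable {I : Type*} [Fintype I] {E : Type*} [MeasurableSpace E]

lemma law_inj (μ : I → Measure E) [∀ i, IsProbabilityMeasure (μ i)] {K : Type*} [Fintype K]
    (j : K → I) (hj : Function.Injective j) :
    (Measure.pi μ).map (fun ω k => ω (j k)) = Measure.pi (fun k => μ (j k)) := by
  have h := iIndepFun_pi (μ := μ) (X := fun _ x => x) (fun i => aemeasurable_id)
  have h2 := h.precomp hj
  have h3 := (iIndepFun_iff_map_fun_eq_pi_map (fun k => by
    exact (measurable_pi_apply _).aemeasurable)).1 h2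
  refine Eq.trans h3 ?_
  congr 1
  ext1 k
  exact (measurePreserving_eval μ (j k)).map_eq

lemma indep_inj (μ : I → Measure E) [∀ i, IsProbabilityMeasure (μ i)] {K K' : Type*} [Fintype K]
    [Fintype K'] (j : K → I) (j' : K' → I) (h : ∀ k k', j k ≠ j' k') :
    IndepFun (fun ω : I → E => fun k => ω (j k)) (fun ω k => ω (j' k)) (Measure.pi μ) := by
  classical
  have hi := iIndepFun_pi (μ := μ) (X := fun _ x => x) (fun i => aemeasurable_id)
  have h2 := hi.indepFun_finset (Finset.univ.image j) (Finset.univ.image j')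
    (by
      rw [Finset.disjoint_left]
      intro a ha hb
      simp only [Finset.mem_image, Finset.mem_univ, true_and] at ha hb
      obtain ⟨k, rfl⟩ := ha
      obtain ⟨k', hk⟩ := hb
      exact h k k' hk.symm) (fun i => measurable_pi_apply i)
  exact h2.comp (φ := fun x k => x ⟨j k, Finset.mem_image_of_mem _ (Finset.mem_univ _)⟩)
    (ψ := fun x k => x ⟨j' k, Finset.mem_image_of_mem _ (Finset.mem_univ _)⟩)
    (by fun_prop) (by fun_prop)

lemma map_uncurry_pi {α β : Type*} [Fintype α] [Fintype β] (ν : α → β → Measure E)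
    [∀ a b, IsProbabilityMeasure (ν a b)] :
    (Measure.pi fun a => Measure.pi (ν a)).map (fun x (p : α × β) => x p.1 p.2)
      = Measure.pi fun p : α × β => ν p.1 p.2 := by
  symm
  refine Measure.pi_eq fun s hs => ?_
  rw [Measure.map_apply (by fun_prop) (MeasurableSet.univ_pi hs)]
  have : (fun (x : α → β → E) (p : α × β) => x p.1 p.2) ⁻¹' Set.univ.pi s
      = Set.univ.pi fun a => Set.univ.pi fun b => s (a, b) := by
    ext x; simp [Set.mem_pi]
  rw [this, Measure.pi_pi]
  simp_rw [Measure.pi_pi]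
  rw [Fintype.prod_prod_type]

lemma law_blocks (μ : I → Measure E) [∀ i, IsProbabilityMeasure (μ i)] {α β : Type*}
    [Fintype α] [Fintype β] (j : α × β → I) (hj : Function.Injective j) :
    (Measure.pi μ).map (fun ω a b => ω (j (a, b)))
      = Measure.pi (fun a => Measure.pi fun b => μ (j (a, b))) := by
  have h1 := law_inj μ j hj
  have h2 := map_uncurry_pi (fun a b => μ (j (a, b)))
  have h3 : (Measure.pi fun a => Measure.pi fun b => μ (j (a, b)))
     = (Measure.pi fun k => μ (j k)).map (fun x a b => x (a, b)) := by
    rw [← h2, Measure.map_map (by fun_prop) (by fun_prop)]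
    exact Measure.map_id.symm
  rw [h3, ← h1, Measure.map_map (by fun_prop) (by fun_prop)]
  rfl

lemma lint_pi_prod {E : I → Type*} [∀ i, MeasurableSpace (E i)] (μ : ∀ i, Measure (E i))
    [∀ i, IsProbabilityMeasure (μ i)] (f : ∀ i, E i → ℝ≥0∞) (hf : ∀ i, Measurable (f i)) :
    ∫⁻ ω, ∏ i, f i (ω i) ∂(Measure.pi μ) = ∏ i, ∫⁻ x, f i x ∂(μ i) := by
  have h := iIndepFun_pi (μ := μ) (X := f) (fun i => (hf i).aemeasurable)
  rw [lintegral_prod_eq_prod_lintegral_of_indepFun Finset.univ _ h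
    (fun i => (hf i).comp (measurable_pi_apply i))]
  refine Finset.prod_congr rfl fun i _ => ?_
  exact (measurePreserving_eval μ i).lintegral_comp (hf i)

lemma pi_wd (μ : I → Measure E) [∀ i, IsProbabilityMeasure (μ i)] (g : I → E → ℝ≥0∞)
    (hg : ∀ i, Measurable (g i)) [∀ i, SigmaFinite ((μ i).withDensity (g i))] :
    Measure.pi (fun i => (μ i).withDensity (g i))
      = (Measure.pi μ).withDensity (fun ω => ∏ i, g i (ω i)) := by
  classical
  refine Measure.pi_eq fun s hs => ?_
  rw [withDensity_apply _ (MeasurableSet.univ_pi hs), ← lintegral_indicator (MeasurableSet.univ_pi hs)]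
  have : ∀ ω : I → E, (Set.univ.pi s).indicator (fun ω => ∏ i, g i (ω i)) ω
      = ∏ i, (s i).indicator (g i) (ω i) := by
    intro ω
    by_cases h : ω ∈ Set.univ.pi s
    · rw [Set.indicator_of_mem h]
      refine Finset.prod_congr rfl fun i _ => ?_
      rw [Set.indicator_of_mem (h i (Set.mem_univ _))]
    · rw [Set.indicator_of_notMem h]
      simp only [Set.mem_pi, Set.mem_univ, true_imp_iff, not_forall] at h
      obtain ⟨i, hi⟩ := h
      exact (Finset.prod_eq_zero (Finset.mem_univ i) (Set.indicator_of_notMem hi _)).symm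
  simp_rw [this]
  rw [lint_pi_prod μ (fun i => (s i).indicator (g i)) (fun i => (hg i).indicator (hs i))]
  refine Finset.prod_congr rfl fun i _ => ?_
  rw [lintegral_indicator (hs i), withDensity_apply _ (hs i)]

end piLemmas

/-- exponent of the density -/
noncomputable def dexp (c a b : ℝ) : ℝ := -(c ^ 2 * (a ^ 2 + b ^ 2) - 2 * c * a * b) / (2 * (1 - c ^ 2))

noncomputable def dens (c : ℝ) (p : ℝ × ℝ) : ℝ≥0∞ :=
  ENNReal.ofReal ((√(1 - c ^ 2))⁻¹ * Real.exp (dexp c p.1 p.2))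

lemma measurable_dens (c : ℝ) : Measurable (dens c) := by unfold dens dexp; fun_prop

lemma pair_wd (c : ℝ) (hc : c ^ 2 < 1) :
    gaussianPair c = ((gaussianReal 0 1).prod (gaussianReal 0 1)).withDensity (dens c) := by
  have h1 : 0 < 1 - c ^ 2 := by linarith
  refine Measure.ext_of_lintegral _ fun f hf => ?_
  rw [lint_pair _ _ hf, lintegral_withDensity_eq_lintegral_mul _ (measurable_dens c) hf,
    lintegral_prod _ ((measurable_dens c).mul hf).aemeasurable]
  refine lintegral_congr fun z => ?_
  have hs : 0 < √(1 - c ^ 2) := Real.sqrt_pos.mpr h1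
  set s := √(1 - c ^ 2) with hsd
  have hs2 : s ^ 2 = 1 - c ^ 2 := Real.sq_sqrt h1.le
  have hmap : (gaussianReal 0 1).map (fun w => c * z + s * w)
      = gaussianReal (c * z) (NNReal.mk (s ^ 2) (sq_nonneg _)) := by
    have : (fun w => c * z + s * w) = (fun w => c * z + w) ∘ (fun w => s * w) := rfl
    rw [this, ← Measure.map_map (by fun_prop) (by fun_prop), gaussianReal_map_const_mul,
      gaussianReal_map_const_add]
    simp
  have hv : NNReal.mk (s ^ 2) (sq_nonneg _) ≠ 0 := by
    intro h
    have : ((NNReal.mk (s ^ 2) (sq_nonneg _) : NNReal) : ℝ) = 0 := by rw [h]; rfl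
    have h' : s ^ 2 = 0 := this
    rw [hs2] at h'; exact h1.ne' h'
  have e1 : ∫⁻ w, f (z, c * z + s * w) ∂(gaussianReal 0 1)
      = ∫⁻ y, f (z, y) ∂((gaussianReal 0 1).map (fun w => c * z + s * w)) := by
    rw [lintegral_map (by fun_prop) (by fun_prop)]
  have hm : Measurable (fun y => (dens c * f) (z, y)) :=
    ((measurable_dens c).mul hf).comp measurable_prodMk_left
  rw [e1, hmap, gaussianReal_of_var_ne_zero _ hv, gaussianReal_of_var_ne_zero _ one_ne_zero,
    lintegral_withDensity_eq_lintegral_mul _ (measurable_gaussianPDF _ _) (by fun_prop),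
    lintegral_withDensity_eq_lintegral_mul _ (measurable_gaussianPDF _ _) hm]
  refine lintegral_congr fun y => ?_
  simp only [Pi.mul_apply]
  rw [← mul_assoc]
  congr 1
  unfold gaussianPDF dens
  rw [← ENNReal.ofReal_mul (gaussianPDFReal_nonneg _ _ _)]
  congr 1
  unfold gaussianPDFReal
  have : ((NNReal.mk (s ^ 2) (sq_nonneg _) : NNReal) : ℝ) = s ^ 2 := rfl
  rw [this, ← hsd]
  have e2 : √(2 * Real.pi * s ^ 2) = √(2 * Real.pi) * s := by
    rw [Real.sqrt_mul (by positivity), Real.sqrt_sq hs.le]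
  rw [e2]
  simp only [NNReal.coe_one, mul_one, sub_zero]
  have : (√(2 * Real.pi))⁻¹ * Real.exp (-y ^ 2 / 2) * (s⁻¹ * Real.exp (dexp c z y))
     = (√(2 * Real.pi) * s)⁻¹ * (Real.exp (-y ^ 2 / 2) * Real.exp (dexp c z y)) := by
    rw [mul_inv]; ring
  rw [this, ← Real.exp_add]
  congr 2
  unfold dexp
  rw [hs2]
  field_simp
  ring

section LR
variable {I : Type*} [Fintype I]

def sig (e : I → I) (ω : I → ℝ × ℝ) (i : I) : ℝ × ℝ := ((ω i).1, (ω (e i)).2)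

lemma measurable_sig (e : I → I) : Measurable (sig e) := by unfold sig; fun_prop

lemma sig_mp (e : I ≃ I) : MeasurePreserving (sig e)
    (Measure.pi fun _ : I => (gaussianReal 0 1).prod (gaussianReal 0 1))
    (Measure.pi fun _ : I => (gaussianReal 0 1).prod (gaussianReal 0 1)) := by
  have h1 := measurePreserving_arrowProdEquivProdArrow ℝ ℝ I (fun _ => gaussianReal 0 1)
    (fun _ => gaussianReal 0 1)
  have h2 : MeasurePreserving (fun (x : I → ℝ) i => x (e i)) (Measure.pi fun _ : I => gaussianReal 0 1)
    (Measure.pi fun _ : I => gaussianReal 0 1) :=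
    ⟨by fun_prop, law_inj (fun _ : I => gaussianReal 0 1) e e.injective⟩
  have h3 := ((MeasurePreserving.id (Measure.pi fun _ : I => gaussianReal 0 1)).prod h2)
  exact (h1.symm.comp h3).comp h1

noncomputable def Dall (c : I → ℝ) (e : I → I) (ω : I → ℝ × ℝ) : ℝ :=
  ∑ i, phi (c i) * ((ω i).1 * ((ω i).2 - (ω (e i)).2))

lemma LR (c : I → ℝ) (hc : ∀ i, c i ^ 2 < 1) (e : I ≃ I) (he : ∀ i, e (e i) = i)
    (hce : ∀ i, c (e i) = c i) (A : Set (I → ℝ × ℝ)) (hA : MeasurableSet A) (M : ℝ) :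
    (Measure.pi fun i => gaussianPair (c i)) (A ∩ {ω | Dall c e ω ≤ M}) ≤
      ENNReal.ofReal (Real.exp M) * (Measure.pi fun i => gaussianPair (c i)) (sig e ⁻¹' A) := by
  set ν := Measure.pi fun _ : I => (gaussianReal 0 1).prod (gaussianReal 0 1) with hν
  set f : (I → ℝ × ℝ) → ℝ≥0∞ := fun ω => ∏ i, dens (c i) (ω i) with hf
  have hfm : Measurable f := by
    rw [hf]; exact Finset.measurable_prod _ fun i _ => (measurable_dens _).comp (measurable_pi_apply i)
  have hP : (Measure.pi fun i => gaussianPair (c i)) = ν.withDensity f := by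
    have : ∀ i, SigmaFinite (((gaussianReal 0 1).prod (gaussianReal 0 1)).withDensity (dens (c i))) := by
      intro i; rw [← pair_wd _ (hc i)]; infer_instance
    rw [hν, hf, ← pi_wd _ _ (fun i => measurable_dens (c i))]
    congr 1; ext1 i; exact pair_wd _ (hc i)
  have hDm : Measurable (Dall c e) := by unfold Dall; fun_prop
  have hss : ∀ ω, sig e (sig e ω) = ω := by
    intro ω; ext i <;> simp [sig, he]
  have hfe : ∀ ω, f ω = ENNReal.ofReal ((∏ i, (√(1 - c i ^ 2))⁻¹) *
      Real.exp (∑ i, dexp (c i) (ω i).1 (ω i).2)) := by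
    intro ω
    simp only [hf, dens]
    rw [← ENNReal.ofReal_prod_of_nonneg (fun i _ => by positivity), Finset.prod_mul_distrib,
      Real.exp_sum]
  have hD : ∀ ω, ∑ i, dexp (c i) (ω i).1 (ω i).2
      = Dall c e ω + ∑ i, dexp (c i) (sig e ω i).1 (sig e ω i).2 := by
    intro ω
    have hx : ∀ i, dexp (c i) (ω i).1 (ω i).2 = phi (c i) * ((ω i).1 * ((ω i).2 - (ω (e i)).2))
        + dexp (c i) (sig e ω i).1 (sig e ω i).2
        + (c i ^ 2 / (2 * (1 - c i ^ 2)) * (ω (e i)).2 ^ 2 - c i ^ 2 / (2 * (1 - c i ^ 2)) * (ω i).2 ^ 2) := by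
      intro i
      have : 1 - c i ^ 2 ≠ 0 := by have := hc i; linarith
      simp only [dexp, sig, phi]
      field_simp
      ring
    rw [Finset.sum_congr rfl fun i _ => hx i, Finset.sum_add_distrib, Finset.sum_add_distrib,
      Finset.sum_sub_distrib]
    have : ∑ i, c i ^ 2 / (2 * (1 - c i ^ 2)) * (ω (e i)).2 ^ 2
        = ∑ i, c i ^ 2 / (2 * (1 - c i ^ 2)) * (ω i).2 ^ 2 := by
      rw [← Equiv.sum_comp e (fun i => c i ^ 2 / (2 * (1 - c i ^ 2)) * (ω i).2 ^ 2)]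
      simp_rw [hce]
    rw [this, Dall]; ring
  have hSA : MeasurableSet (sig e ⁻¹' A) := measurable_sig e hA
  have hB : MeasurableSet (A ∩ {ω | Dall c e ω ≤ M}) := hA.inter (measurableSet_le hDm measurable_const)
  rw [hP, withDensity_apply _ hSA, withDensity_apply _ hB]
  have e1 : ∫⁻ ω in sig e ⁻¹' A, f ω ∂ν = ∫⁻ ω in A, f (sig e ω) ∂ν := by
    rw [← lintegral_indicator hSA, ← lintegral_indicator hA,
      ← (sig_mp e).lintegral_comp (hfm.indicator hSA)]
    refine lintegral_congr fun ω => ?_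
    by_cases h : ω ∈ A
    · rw [Set.indicator_of_mem h, Set.indicator_of_mem (by simpa [hss] using h)]
    · rw [Set.indicator_of_notMem h, Set.indicator_of_notMem (by simpa [hss] using h)]
  have hm : Measurable (fun ω => f (sig e ω)) := hfm.comp (measurable_sig e)
  rw [e1, ← lintegral_const_mul _ hm]
  calc ∫⁻ ω in A ∩ {ω | Dall c e ω ≤ M}, f ω ∂ν
      ≤ ∫⁻ ω in A ∩ {ω | Dall c e ω ≤ M}, ENNReal.ofReal (Real.exp M) * f (sig e ω) ∂ν := by
        refine setLIntegral_mono' hB fun ω hω => ?_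
        rw [hfe, hfe, ← ENNReal.ofReal_mul (Real.exp_nonneg _)]
        apply ENNReal.ofReal_le_ofReal
        rw [hD ω, Real.exp_add, mul_left_comm]
        have := Real.exp_le_exp.mpr hω.2
        gcongr
    _ ≤ _ := lintegral_mono_set Set.inter_subset_left

end LR

abbrev Idx (n d : ℕ) := Sym2 (Fin n) ⊕ (Fin n × Fin d)

def cc {n d : ℕ} (ρ r : ℝ) : Idx n d → ℝ := Sum.elim (fun _ => ρ) (fun _ => r)

noncomputable def PP (n d : ℕ) (ρ r : ℝ) : Measure (Idx n d → ℝ × ℝ) :=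
  Measure.pi fun i => gaussianPair (cc ρ r i)

instance (n d : ℕ) (ρ r : ℝ) : IsProbabilityMeasure (PP n d ρ r) := by unfold PP; infer_instance

def act {n d : ℕ} (π : Equiv.Perm (Fin n)) : Idx n d → Idx n d :=
  Sum.map (Sym2.map π) (Prod.map π id)

def ob {n d : ℕ} (π : Equiv.Perm (Fin n)) (ω : Idx n d → ℝ × ℝ) : Obs n d :=
  (fun e => (ω (.inl e.1)).1, fun f => (ω (.inl (Sym2.map (⇑(π⁻¹ : Equiv.Perm (Fin n))) f.1))).2,
   fun v i => (ω (.inr (v, i))).1, fun v i => (ω (.inr (π⁻¹ v, i))).2)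

lemma measurable_ob {n d : ℕ} (π : Equiv.Perm (Fin n)) : Measurable (ob (d := d) π) := by
  unfold ob; fun_prop

lemma featurePair_eq (d : ℕ) (r : ℝ) : featurePair d r =
    (Measure.pi fun _ : Fin d => gaussianPair r).map (fun x => (fun i => (x i).1, fun i => (x i).2)) := by
  have h1 := (measurePreserving_arrowProdEquivProdArrow ℝ ℝ (Fin d) (fun _ => gaussianReal 0 1)
    (fun _ => gaussianReal 0 1))
  unfold featurePair
  rw [← h1.map_eq, Measure.map_map (by fun_prop) (by exact h1.measurable)]
  have h2 : (Measure.pi fun _ : Fin d => gaussianPair r) =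
      (Measure.pi fun _ : Fin d => (gaussianReal 0 1).prod (gaussianReal 0 1)).map
        (fun x i => ((x i).1, r * (x i).1 + √(1 - r ^ 2) * (x i).2)) := by
    have : ∀ _ : Fin d, SigmaFinite (Measure.map (fun z : ℝ × ℝ => (z.1, r * z.1 + √(1 - r ^ 2) * z.2))
      ((gaussianReal 0 1).prod (gaussianReal 0 1))) := fun _ => by
        change SigmaFinite (gaussianPair r); infer_instance
    rw [Measure.pi_map_pi (f := fun (_ : Fin d) (z : ℝ × ℝ) => (z.1, r * z.1 + √(1 - r ^ 2) * z.2))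
      (fun i => by fun_prop)]
    rfl
  rw [h2, Measure.map_map (by fun_prop) (by fun_prop)]
  rfl

lemma sample_eq (n d : ℕ) (ρ r : ℝ) : sample n d ρ r = (PP n d ρ r).map
    (fun ω => (fun e : Edge n => ω (.inl e.1),
      fun v => (fun i => (ω (.inr (v, i))).1, fun i => (ω (.inr (v, i))).2))) := by
  set c : Idx n d → ℝ := cc ρ r with hc
  have hI := indep_inj (fun i => gaussianPair (c i)) (fun e : Edge n => (Sum.inl e.1 : Idx n d))
    (fun p : Fin n × Fin d => (Sum.inr p : Idx n d)) (fun _ _ => by simp)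
  have hI2 := hI.comp (φ := fun x => x)
    (ψ := fun (x : Fin n × Fin d → ℝ × ℝ) v => ((fun i => (x (v, i)).1 : Fin d → ℝ), (fun i => (x (v, i)).2 : Fin d → ℝ)))
    measurable_id (by fun_prop)
  rw [indepFun_iff_map_prod_eq_prod_map_map (by exact (measurable_pi_lambda _ fun k => measurable_pi_apply _).aemeasurable) (by fun_prop)] at hI2
  refine Eq.trans ?_ hI2.symm
  unfold sample
  congr 1
  · have := law_inj (fun i => gaussianPair (c i)) (fun e : Edge n => (Sum.inl e.1 : Idx n d))
      (fun a b h => Subtype.ext (Sum.inl_injective h))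
    exact this.symm
  · have h1 := law_blocks (fun i => gaussianPair (c i)) (fun p : Fin n × Fin d => (Sum.inr p : Idx n d))
      Sum.inr_injective
    have h2 : (Measure.pi fun _ : Fin n => featurePair d r) =
      (Measure.pi fun _ : Fin n => Measure.pi fun _ : Fin d => gaussianPair r).map
        (fun x v => (fun i => (x v i).1, fun i => (x v i).2)) := by
      have : ∀ _ : Fin n, SigmaFinite (Measure.map (fun x : Fin d → ℝ × ℝ => ((fun i => (x i).1 : Fin d → ℝ), (fun i => (x i).2 : Fin d → ℝ)))
        (Measure.pi fun _ : Fin d => gaussianPair r)) := fun _ =>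
          have := Measure.isProbabilityMeasure_map (μ := Measure.pi fun _ : Fin d => gaussianPair r)
            (f := fun x : Fin d → ℝ × ℝ => ((fun i => (x i).1 : Fin d → ℝ), (fun i => (x i).2 : Fin d → ℝ))) (by fun_prop)
          inferInstance
      rw [Measure.pi_map_pi (f := fun (_ : Fin n) (x : Fin d → ℝ × ℝ) => ((fun i => (x i).1 : Fin d → ℝ), (fun i => (x i).2 : Fin d → ℝ)))
        (fun i => by fun_prop)]
      congr 1; ext1 v; exact featurePair_eq d r
    rw [h2]
    have h3 : (Measure.pi fun _ : Fin n => Measure.pi fun _ : Fin d => gaussianPair r)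
      = Measure.map (fun (ω : Idx n d → ℝ × ℝ) a b => ω (Sum.inr (a, b)))
       (Measure.pi fun i => gaussianPair (c i)) := h1.symm
    rw [h3, Measure.map_map (by fun_prop) (by fun_prop)]
    rfl

lemma obsLaw_eq (n d : ℕ) (ρ r : ℝ) (π : Equiv.Perm (Fin n)) :
    obsLaw n d ρ r π = (PP n d ρ r).map (ob π) := by
  unfold obsLaw
  rw [sample_eq, Measure.map_map (by unfold obsOf; fun_prop) (by fun_prop)]
  rfl

lemma ob_mul {n d : ℕ} (π τ : Equiv.Perm (Fin n)) (hτ : τ⁻¹ = τ) (ω : Idx n d → ℝ × ℝ) :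
    ob (π * τ) ω = ob π (sig (act τ) ω) := by
  unfold ob sig act
  simp only [mul_inv_rev, hτ, Sum.map_inl, Sum.map_inr, Prod.map, Equiv.Perm.coe_mul, Sym2.map_map, id, Function.comp]



section Q2
variable {I : Type*} {α : Type*} [Fintype α]

noncomputable def Q2 (c' : α → ℝ) (j : α × Fin 2 → I) (ω : I → ℝ × ℝ) : ℝ :=
  ∑ k, phi (c' k) * (((ω (j (k, 0))).1 - (ω (j (k, 1))).1) * ((ω (j (k, 0))).2 - (ω (j (k, 1))).2))

lemma measurable_Q2 (c' : α → ℝ) (j : α × Fin 2 → I) : Measurable (Q2 c' j) := by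
  unfold Q2; fun_prop

lemma mgf2 [Fintype I] (c : I → ℝ) (c' : α → ℝ) (j : α × Fin 2 → I) (hj : Function.Injective j)
    (hcj : ∀ k b, c (j (k, b)) = c' k) (t : ℝ) (hc : ∀ k, c' k ^ 2 < 1)
    (ht : ∀ k, c' k ^ 2 * (1 - 2 * t) ^ 2 < 1) :
    ∫⁻ ω, ENNReal.ofReal (Real.exp (-t * Q2 c' j ω)) ∂(Measure.pi fun i => gaussianPair (c i))
      = ∏ k, ENNReal.ofReal (F2 (c' k) t) := by
  set f : α → (Fin 2 → ℝ × ℝ) → ℝ≥0∞ := fun k x =>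
    ENNReal.ofReal (Real.exp (-t * (phi (c' k) * (((x 0).1 - (x 1).1) * ((x 0).2 - (x 1).2))))) with hf
  have hfm : ∀ k, Measurable (f k) := by intro k; simp only [hf]; fun_prop
  have h1 : ∀ ω : I → ℝ × ℝ, ENNReal.ofReal (Real.exp (-t * Q2 c' j ω))
      = ∏ k, f k ((fun ω a b => ω (j (a, b)) : (I → ℝ × ℝ) → α → Fin 2 → ℝ × ℝ) ω k) := by
    intro ω
    simp only [hf, Q2]
    rw [Finset.mul_sum, Real.exp_sum, ENNReal.ofReal_prod_of_nonneg (fun i _ => by positivity)]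
  have hF : Measurable (fun x : α → Fin 2 → ℝ × ℝ => ∏ k, f k (x k)) :=
    Finset.measurable_prod _ fun k _ => (hfm k).comp (measurable_pi_apply k)
  refine (lintegral_congr h1).trans ?_
  refine (lintegral_map (μ := Measure.pi fun i => gaussianPair (c i)) hF
    (g := fun ω a b => ω (j (a, b))) (by fun_prop)).symm.trans ?_
  rw [law_blocks (fun i => gaussianPair (c i)) j hj, lint_pi_prod _ _ hfm]
  refine Finset.prod_congr rfl fun k _ => ?_
  simp_rw [hcj]
  exact block2 (c' k) t (hc k) (ht k)

lemma mgf3 [Fintype I] (c : I → ℝ) (c' : α → ℝ) (j : α × Fin 3 → I) (hj : Function.Injective j)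
    (hcj : ∀ k b, c (j (k, b)) = c' k) (hc : ∀ k, c' k ^ 2 < 1) :
    ∫⁻ ω, ENNReal.ofReal (Real.exp (-(1/2) * (Q2 c' (fun p => j (p.1, ![0, 1] p.2)) ω
        + Q2 c' (fun p => j (p.1, ![0, 2] p.2)) ω))) ∂(Measure.pi fun i => gaussianPair (c i))
      = ∏ k, ENNReal.ofReal (F3 (c' k)) := by
  set f : α → (Fin 3 → ℝ × ℝ) → ℝ≥0∞ := fun k x =>
    ENNReal.ofReal (Real.exp (-(1/2) * (phi (c' k) * (((x 0).1 - (x 1).1) * ((x 0).2 - (x 1).2))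
     + phi (c' k) * (((x 0).1 - (x 2).1) * ((x 0).2 - (x 2).2))))) with hf
  have hfm : ∀ k, Measurable (f k) := by intro k; simp only [hf]; fun_prop
  have h1 : ∀ ω : I → ℝ × ℝ, ENNReal.ofReal (Real.exp (-(1/2) * (Q2 c' (fun p => j (p.1, ![0, 1] p.2)) ω
        + Q2 c' (fun p => j (p.1, ![0, 2] p.2)) ω)))
      = ∏ k, f k ((fun ω a b => ω (j (a, b)) : (I → ℝ × ℝ) → α → Fin 3 → ℝ × ℝ) ω k) := by
    intro ω
    simp only [hf, Q2]
    rw [← Finset.sum_add_distrib, Finset.mul_sum, Real.exp_sum,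
      ENNReal.ofReal_prod_of_nonneg (fun i _ => by positivity)]
    rfl
  have hF : Measurable (fun x : α → Fin 3 → ℝ × ℝ => ∏ k, f k (x k)) :=
    Finset.measurable_prod _ fun k _ => (hfm k).comp (measurable_pi_apply k)
  refine (lintegral_congr h1).trans ?_
  refine (lintegral_map (μ := Measure.pi fun i => gaussianPair (c i)) hF
    (g := fun ω a b => ω (j (a, b))) (by fun_prop)).symm.trans ?_
  rw [law_blocks (fun i => gaussianPair (c i)) j hj, lint_pi_prod _ _ hfm]
  refine Finset.prod_congr rfl fun k _ => ?_
  simp_rw [hcj]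
  exact block3 (c' k) (hc k)

end Q2

section decomp
variable {n d : ℕ}

abbrev J0 (n d L : ℕ) := {w : Fin n // ¬ w.val < L} ⊕ Fin d
abbrev JR (n L : ℕ) (v : Fin n) := {w : Fin n // w.val < L ∧ w ≠ v}

def jx {L : ℕ} (x : Fin n) : J0 n d L → Idx n d :=
  Sum.elim (fun w => .inl s(x, w.1)) (fun i => .inr (x, i))

def c0 {L : ℕ} (ρ r : ℝ) : J0 n d L → ℝ := Sum.elim (fun _ => ρ) (fun _ => r)

lemma cc_jx {L : ℕ} (ρ r : ℝ) (x : Fin n) (k : J0 n d L) : cc ρ r (jx x k) = c0 ρ r k := by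
  rcases k with k | k <;> rfl

lemma jx_inj {L : ℕ} {x y : Fin n} (hx : x.val < L) (hy : y.val < L) {k k' : J0 n d L}
    (h : jx x k = jx y k') : x = y ∧ k = k' := by
  rcases k with ⟨w, hw⟩ | k <;> rcases k' with ⟨w', hw'⟩ | k' <;>
    simp only [jx, Sum.elim_inl, Sum.elim_inr, Sum.inl.injEq, Sum.inr.injEq, Prod.mk.injEq,
      Sym2.eq_iff, reduceCtorEq] at h
  · rcases h with ⟨h1, h2⟩ | ⟨h1, h2⟩
    · subst h1 h2; exact ⟨rfl, rfl⟩
    · subst h1; exact absurd hx hw'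
  · exact ⟨h.1, by rw [h.2]⟩

def j2 (L : ℕ) (x y : Fin n) : J0 n d L × Fin 2 → Idx n d := fun p => jx (![x, y] p.2) p.1

def j3 (L : ℕ) (x y z : Fin n) : J0 n d L × Fin 3 → Idx n d := fun p => jx (![x, y, z] p.2) p.1

def jr (L : ℕ) (u v : Fin n) : JR n L v × Fin 2 → Idx n d :=
  fun p => .inl (![s(u, p.1.1), s(v, Equiv.swap u v p.1.1)] p.2)

lemma j2_inj {L : ℕ} {x y : Fin n} (hx : x.val < L) (hy : y.val < L) (hxy : x ≠ y) :
    Function.Injective (j2 (d := d) L x y) := by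
  rintro ⟨k, b⟩ ⟨k', b'⟩ h
  have := jx_inj (by fin_cases b <;> simpa) (by fin_cases b' <;> simpa) h
  obtain ⟨h1, rfl⟩ := this
  fin_cases b <;> fin_cases b' <;> simp_all

lemma j3_inj {L : ℕ} {x y z : Fin n} (hx : x.val < L) (hy : y.val < L) (hz : z.val < L)
    (hxy : x ≠ y) (hxz : x ≠ z) (hyz : y ≠ z) :
    Function.Injective (j3 (d := d) L x y z) := by
  rintro ⟨k, b⟩ ⟨k', b'⟩ h
  have := jx_inj (by fin_cases b <;> simpa) (by fin_cases b' <;> simpa) h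
  obtain ⟨h1, rfl⟩ := this
  fin_cases b <;> fin_cases b' <;> simp_all

lemma swap_ne {u v w : Fin n} (h : w ≠ v) : Equiv.swap u v w ≠ u := by
  intro h'
  apply h
  have := congrArg (Equiv.swap u v) h'
  simpa using this

lemma jr_inj {L : ℕ} {u v : Fin n} (huv : u ≠ v) :
    Function.Injective (jr (d := d) L u v) := by
  rintro ⟨⟨k, hk⟩, b⟩ ⟨⟨k', hk'⟩, b'⟩ h
  have a1 := swap_ne (u := u) hk.2
  have a2 := swap_ne (u := u) hk'.2
  have a3 := hk.2
  have a4 := hk'.2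
  fin_cases b <;> fin_cases b' <;> simp [jr] at h ⊢ <;> grind

noncomputable def D0 (L : ℕ) (ρ r : ℝ) (u v : Fin n) (ω : Idx n d → ℝ × ℝ) : ℝ :=
  Q2 (c0 ρ r) (j2 L u v) ω

noncomputable def RR (L : ℕ) (ρ : ℝ) (u v : Fin n) (ω : Idx n d → ℝ × ℝ) : ℝ :=
  Q2 (fun _ => ρ) (jr L u v) ω

lemma D0_symm (L : ℕ) (ρ r : ℝ) (u v : Fin n) (ω : Idx n d → ℝ × ℝ) :
    D0 L ρ r u v ω = D0 L ρ r v u ω := by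
  unfold D0 Q2 j2
  refine Finset.sum_congr rfl fun k _ => ?_
  simp only [Matrix.cons_val_zero, Matrix.cons_val_one]
  ring

def jall (L : ℕ) (u v : Fin n) : (J0 n d L ⊕ JR n L v) × Fin 2 → Idx n d :=
  fun p => Sum.elim (fun k => j2 L u v (k, p.2)) (fun k => jr L u v (k, p.2)) p.1

lemma jr_ne_j2 {L : ℕ} {u v x y : Fin n} (hu : u.val < L) (hv : v.val < L) 
    (p : J0 n d L × Fin 2) (q : JR n L v × Fin 2) : j2 (d := d) L x y p ≠ jr L u v q := by
  intro h
  obtain ⟨k, b⟩ := p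
  obtain ⟨⟨w, hw⟩, b'⟩ := q
  have hs : (Equiv.swap u v w).val < L := by
    rw [Equiv.swap_apply_def]; split_ifs <;> tauto
  rcases k with ⟨k, hk⟩ | k
  · fin_cases b <;> fin_cases b' <;> simp [j2, jx, jr, Sym2.eq_iff] at h <;> grind
  · simp [j2, jx, jr] at h

lemma jall_inj {L : ℕ} {u v : Fin n} (hu : u.val < L) (hv : v.val < L) (huv : u ≠ v) :
    Function.Injective (jall (d := d) L u v) := by
  rintro ⟨k | k, b⟩ ⟨k' | k', b'⟩ h
  · have := j2_inj hu hv huv h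
    simp_all
  · exact absurd h (jr_ne_j2 hu hv _ _)
  · exact absurd h.symm (jr_ne_j2 hu hv _ _)
  · have := jr_inj huv h
    simp_all

lemma jall_range {L : ℕ} {u v : Fin n} (hu : u.val < L) (hv : v.val < L) (huv : u ≠ v) (i : Idx n d)
    (hi : act (Equiv.swap u v) i ≠ i) : i ∈ Set.range (jall L u v) := by
  rcases i with e | ⟨x, i⟩
  · have key : (∃ w, w ≠ v ∧ (e = s(u, w) ∨ e = s(v, Equiv.swap u v w))) := by
      induction e using Sym2.ind with
      | _ x y =>
        have hne : s(Equiv.swap u v x, Equiv.swap u v y) ≠ s(x, y) := by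
          intro h; apply hi; simp only [act, Sum.map_inl, Sym2.map_mk]; rw [h]
        by_cases hxu : x = u
        · refine ⟨y, ?_, by simp [hxu]⟩
          rintro rfl; apply hne; simp [hxu, Sym2.eq_swap]
        by_cases hyu : y = u
        · refine ⟨x, ?_, by simp [hyu, Sym2.eq_swap]⟩
          rintro rfl; apply hne; simp [hyu, Sym2.eq_swap]
        by_cases hxv : x = v
        · refine ⟨Equiv.swap u v y, ?_, by simp [hxv]⟩
          intro h; apply hyu; have := congrArg (Equiv.swap u v) h; simpa using this
        by_cases hyv : y = v
        · refine ⟨Equiv.swap u v x, ?_, by simp [hyv, Sym2.eq_swap]⟩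
          intro h; apply hxu; have := congrArg (Equiv.swap u v) h; simpa using this
        · exfalso; apply hne; rw [Equiv.swap_apply_of_ne_of_ne hxu hxv, Equiv.swap_apply_of_ne_of_ne hyu hyv]
    obtain ⟨w, hwv, hw⟩ := key
    by_cases hL : w.val < L
    · rcases hw with rfl | rfl
      · exact ⟨(.inr ⟨w, hL, hwv⟩, 0), rfl⟩
      · exact ⟨(.inr ⟨w, hL, hwv⟩, 1), rfl⟩
    · have hwu : w ≠ u := by rintro rfl; exact hL hu
      rw [Equiv.swap_apply_of_ne_of_ne hwu hwv] at hw
      rcases hw with rfl | rfl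
      · exact ⟨(.inl (.inl ⟨w, hL⟩), 0), rfl⟩
      · exact ⟨(.inl (.inl ⟨w, hL⟩), 1), rfl⟩
  · by_cases hxu : x = u
    · subst hxu; exact ⟨(.inl (.inr i), 0), rfl⟩
    by_cases hxv : x = v
    · subst hxv; exact ⟨(.inl (.inr i), 1), rfl⟩
    exfalso; apply hi
    simp [act, Equiv.swap_apply_of_ne_of_ne hxu hxv]

lemma act_jall {L : ℕ} {u v : Fin n} (hu : u.val < L) (hv : v.val < L)
    (k : J0 n d L ⊕ JR n L v) : act (Equiv.swap u v) (jall L u v (k, 0)) = jall L u v (k, 1) ∧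
      act (Equiv.swap u v) (jall L u v (k, 1)) = jall L u v (k, 0) := by
  rcases k with (⟨k, hk⟩ | k) | k
  · have h1 : k ≠ u := by rintro rfl; exact hk hu
    have h2 : k ≠ v := by rintro rfl; exact hk hv
    simp [jall, j2, jx, act, Equiv.swap_apply_of_ne_of_ne h1 h2]
  · simp [jall, j2, jx, act]
  · simp [jall, jr, act]

lemma D_decomp {L : ℕ} (ρ r : ℝ) {u v : Fin n} (hu : u.val < L) (hv : v.val < L) (huv : u ≠ v)
    (ω : Idx n d → ℝ × ℝ) :
    Dall (cc ρ r) (act (Equiv.swap u v)) ω = D0 L ρ r u v ω + RR L ρ u v ω := by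
  unfold Dall
  rw [← Fintype.sum_of_injective (jall L u v) (jall_inj hu hv huv)
    (fun p => phi (cc ρ r (jall L u v p)) * ((ω (jall L u v p)).1 *
      ((ω (jall L u v p)).2 - (ω (act (Equiv.swap u v) (jall L u v p))).2))) _ ?_ (fun _ => rfl)]
  · rw [Fintype.sum_prod_type]
    simp_rw [Fin.sum_univ_two, (act_jall hu hv _).1, (act_jall hu hv _).2]
    rw [Fintype.sum_sum_type]
    unfold D0 RR Q2
    congr 1
    · refine Finset.sum_congr rfl fun k _ => ?_
      have h1 : ∀ b : Fin 2, cc ρ r (jall L u v (Sum.inl k, b)) = c0 ρ r k := fun b => cc_jx _ _ _ _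
      rw [h1, h1]
      simp only [jall, Sum.elim_inl]
      ring
    · refine Finset.sum_congr rfl fun k _ => ?_
      have h1 : ∀ b : Fin 2, cc ρ r (jall (d := d) L u v (Sum.inr k, b)) = ρ := fun b => rfl
      rw [h1, h1]
      simp only [jall, Sum.elim_inr]
      ring
  · intro i hi
    have : act (Equiv.swap u v) i = i := by
      by_contra h; exact hi (jall_range hu hv huv i h)
    rw [this]; simp

lemma measurable_D0 (L : ℕ) (ρ r : ℝ) (u v : Fin n) : Measurable (D0 (d := d) L ρ r u v) :=
  measurable_Q2 _ _

lemma measurable_RR (L : ℕ) (ρ : ℝ) (u v : Fin n) : Measurable (RR (d := d) L ρ u v) :=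
  measurable_Q2 _ _

lemma indep_Q2 {I α β : Type*} [Fintype I] [Fintype α] [Fintype β] (c : I → ℝ) (a : α → ℝ) (b : β → ℝ)
    (j : α × Fin 2 → I) (j' : β × Fin 2 → I) (h : ∀ k k', j k ≠ j' k') :
    IndepFun (Q2 a j) (Q2 b j') (Measure.pi fun i => gaussianPair (c i)) := by
  have := indep_inj (fun i => gaussianPair (c i)) j j' h
  exact this.comp (φ := Q2 a id) (ψ := Q2 b id) (measurable_Q2 _ _) (measurable_Q2 _ _)

lemma indep_D0_RR {L : ℕ} (ρ r : ℝ) {u v : Fin n} (hu : u.val < L) (hv : v.val < L) :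
    IndepFun (D0 (d := d) L ρ r u v) (RR L ρ u v) (PP n d ρ r) :=
  indep_Q2 _ _ _ _ _ (jr_ne_j2 hu hv)

lemma indep_D0_D0 {L : ℕ} (ρ r : ℝ) {u v u' v' : Fin n} (hu : u.val < L) (hv : v.val < L)
    (hu' : u'.val < L) (hv' : v'.val < L) (h1 : u ≠ u') (h2 : u ≠ v') (h3 : v ≠ u') (h4 : v ≠ v') :
    IndepFun (D0 (d := d) L ρ r u v) (D0 L ρ r u' v') (PP n d ρ r) := by
  refine indep_Q2 _ _ _ _ _ ?_
  rintro ⟨k, b⟩ ⟨k', b'⟩ h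
  have := (jx_inj (by fin_cases b <;> simpa) (by fin_cases b' <;> simpa) h).1
  fin_cases b <;> fin_cases b' <;> simp at this <;> contradiction

lemma card_W (L : ℕ) (hL : L ≤ n) : Fintype.card {w : Fin n // ¬ w.val < L} = n - L := by
  rw [Fintype.card_subtype_compl, Fintype.card_fin]
  congr 1
  rw [Fintype.card_subtype]
  have : (Finset.univ.filter fun x : Fin n => x.val < L) = Finset.univ.map (Fin.castLEEmb hL) := by
    ext x; simp only [Finset.mem_filter, Finset.mem_univ, true_and, Finset.mem_map, Fin.castLEEmb_apply]
    exact ⟨fun h => ⟨⟨x, h⟩, rfl⟩, by rintro ⟨a, rfl⟩; exact a.2⟩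
  rw [this]; simp

lemma card_JR (L : ℕ) (hL : L ≤ n) (v : Fin n) : Fintype.card (JR n L v) ≤ L := by
  have : Fintype.card (JR n L v) ≤ Fintype.card (Fin L) :=
    Fintype.card_le_of_injective (fun w => ⟨w.1.val, w.2.1⟩) (fun a b h => by
      simp only [Fin.mk.injEq] at h; exact Subtype.ext (Fin.ext h))
  simpa using this

lemma mgf_D0 {L : ℕ} (hL : L ≤ n) (ρ r : ℝ) (hρ : ρ ^ 2 < 1) (hr : r ^ 2 < 1) (t : ℝ) (ht : (1 - 2 * t) ^ 2 ≤ 1)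
    {u v : Fin n} (hu : u.val < L) (hv : v.val < L) (huv : u ≠ v) :
    ∫⁻ ω, ENNReal.ofReal (Real.exp (-t * D0 L ρ r u v ω)) ∂(PP n d ρ r)
      = ENNReal.ofReal (F2 ρ t) ^ (n - L) * ENNReal.ofReal (F2 r t) ^ d := by
  have h := mgf2 (cc ρ r) (c0 ρ r) (j2 (d := d) L u v) (j2_inj hu hv huv)
    (fun k b => cc_jx _ _ _ _) t (by rintro (k | k) <;> simp only [c0, Sum.elim_inl, Sum.elim_inr] <;> assumption)
    (by rintro (k | k) <;> simp only [c0, Sum.elim_inl, Sum.elim_inr]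
        · nlinarith [sq_nonneg ρ]
        · nlinarith [sq_nonneg r])
  refine h.trans ?_
  rw [Fintype.prod_sum_type]
  simp only [c0, Sum.elim_inl, Sum.elim_inr, Finset.prod_const, Finset.card_univ, card_W L hL, Fintype.card_fin]

lemma mgf_D03 {L : ℕ} (hL : L ≤ n) (ρ r : ℝ) (hρ : ρ ^ 2 < 1) (hr : r ^ 2 < 1) 
    {u v v' : Fin n} (hu : u.val < L) (hv : v.val < L) (hv' : v'.val < L) (huv : u ≠ v) (huv' : u ≠ v')
    (hvv' : v ≠ v') :
    ∫⁻ ω, ENNReal.ofReal (Real.exp (-(1/2) * (D0 L ρ r u v ω + D0 L ρ r u v' ω))) ∂(PP n d ρ r)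
      = ENNReal.ofReal (F3 ρ) ^ (n - L) * ENNReal.ofReal (F3 r) ^ d := by
  have h := mgf3 (cc ρ r) (c0 ρ r) (j3 (d := d) L u v v') (j3_inj hu hv hv' huv huv' hvv')
    (fun k b => cc_jx _ _ _ _) (by rintro (k | k) <;> simp only [c0, Sum.elim_inl, Sum.elim_inr] <;> assumption)
  refine Eq.trans ?_ (h.trans ?_)
  · rfl
  rw [Fintype.prod_sum_type]
  simp only [c0, Sum.elim_inl, Sum.elim_inr, Finset.prod_const, Finset.card_univ, card_W L hL, Fintype.card_fin]

lemma mgf_RR {L : ℕ} (ρ r : ℝ) (hρ : 9 * ρ ^ 2 < 1) 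
    {u v : Fin n} (huv : u ≠ v) :
    ∫⁻ ω, ENNReal.ofReal (Real.exp (RR L ρ u v ω)) ∂(PP n d ρ r)
      = ENNReal.ofReal (F2 ρ (-1)) ^ (Fintype.card (JR n L v)) := by
  have h := mgf2 (cc ρ r) (fun _ => ρ) (jr (d := d) L u v) (jr_inj huv)
    (fun k b => rfl) (-1) (fun _ => by nlinarith [sq_nonneg ρ]) (fun _ => by linarith)
  rw [Finset.prod_const, Finset.card_univ] at h
  rw [← h]
  refine lintegral_congr fun ω => ?_
  simp [RR]

end decomp


section second
variable {Ω : Type*} [MeasurableSpace Ω] (μ : Measure Ω) [IsProbabilityMeasure μ] {T : Type*} [Fintype T]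

lemma integrable_ind {E : Set Ω} (hE : MeasurableSet E) : Integrable (E.indicator (1 : Ω → ℝ)) μ :=
  (integrable_const (1 : ℝ)).indicator hE

lemma markov_real (f : Ω → ℝ) (hf : Integrable f μ) (h0 : ∀ ω, 0 ≤ f ω) (a : ℝ) (ha : 0 < a) :
    μ.real {ω | a ≤ f ω} ≤ (∫ ω, f ω ∂μ) / a := by
  rw [le_div_iff₀ ha, mul_comm]
  exact mul_meas_ge_le_integral_of_nonneg (Eventually.of_forall h0) hf a

lemma second_moment (E F : T → Set Ω) (hE : ∀ τ, MeasurableSet (E τ)) (hF : ∀ τ, MeasurableSet (F τ))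
    (bad : T → T → Prop) [∀ a b, Decidable (bad a b)] (S B η : ℝ) (hS : S = ∑ τ, μ.real (E τ)) (hS0 : 0 < S)
    (h1 : ∀ τ τ', ¬ bad τ τ' → μ.real (E τ ∩ E τ') = μ.real (E τ) * μ.real (E τ'))
    (h2 : ∀ τ, μ.real (E τ ∩ F τ) ≤ η * μ.real (E τ))
    (h3 : ∑ τ, ∑ τ', (if bad τ τ' then μ.real (E τ ∩ E τ') else 0) ≤ B) :
    μ.real {ω | ∑ τ, (E τ \ F τ).indicator (1 : Ω → ℝ) ω < S / 4} ≤ 4 * B / S ^ 2 + 4 * η := by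
  set X : Ω → ℝ := fun ω => ∑ τ, (E τ).indicator (1 : Ω → ℝ) ω with hX
  set Y : Ω → ℝ := fun ω => ∑ τ, (E τ ∩ F τ).indicator (1 : Ω → ℝ) ω with hY
  have hXi : Integrable X μ := integrable_finsetSum _ fun τ _ => integrable_ind μ (hE τ)
  have hYi : Integrable Y μ := integrable_finsetSum _ fun τ _ => integrable_ind μ ((hE τ).inter (hF τ))
  have hN : ∀ ω, ∑ τ, (E τ \ F τ).indicator (1 : Ω → ℝ) ω = X ω - Y ω := by
    intro ω
    simp only [hX, hY]
    rw [← Finset.sum_sub_distrib]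
    refine Finset.sum_congr rfl fun τ _ => ?_
    by_cases a : ω ∈ E τ <;> by_cases b : ω ∈ F τ <;> simp [a, b]
  have hsub : {ω | ∑ τ, (E τ \ F τ).indicator (1 : Ω → ℝ) ω < S / 4} ⊆
      {ω | S ^ 2 / 4 ≤ (X ω - S) ^ 2} ∪ {ω | S / 4 ≤ Y ω} := by
    intro ω hω
    simp only [Set.mem_ofPred_eq, hN] at hω
    by_cases h : S / 4 ≤ Y ω
    · exact Or.inr h
    · left
      simp only [Set.mem_ofPred_eq]
      nlinarith
  have hY1 : ∫ ω, Y ω ∂μ ≤ η * S := by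
    simp only [hY]
    rw [integral_finsetSum _ fun τ _ => integrable_ind μ ((hE τ).inter (hF τ)), hS, Finset.mul_sum]
    refine Finset.sum_le_sum fun τ _ => ?_
    rw [integral_indicator_one ((hE τ).inter (hF τ))]
    exact h2 τ
  have hp : ∀ τ τ', Integrable (fun ω => ((E τ).indicator (1 : Ω → ℝ) ω - μ.real (E τ)) *
      ((E τ').indicator (1 : Ω → ℝ) ω - μ.real (E τ'))) μ ∧
      ∫ ω, ((E τ).indicator (1 : Ω → ℝ) ω - μ.real (E τ)) *
      ((E τ').indicator (1 : Ω → ℝ) ω - μ.real (E τ')) ∂μ = μ.real (E τ ∩ E τ') - μ.real (E τ) * μ.real (E τ') := by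
    intro τ τ'
    have e : (fun ω => ((E τ).indicator (1 : Ω → ℝ) ω - μ.real (E τ)) *
      ((E τ').indicator (1 : Ω → ℝ) ω - μ.real (E τ'))) = fun ω =>
       (((E τ ∩ E τ').indicator (1 : Ω → ℝ) ω - μ.real (E τ') * (E τ).indicator (1 : Ω → ℝ) ω)
        - μ.real (E τ) * (E τ').indicator (1 : Ω → ℝ) ω) + μ.real (E τ) * μ.real (E τ') := by
      funext ω
      rw [Set.inter_indicator_one]
      simp only [Pi.mul_apply]
      ring
    have i1 := integrable_ind μ ((hE τ).inter (hE τ'))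
    have i2 := (integrable_ind μ (hE τ)).const_mul (μ.real (E τ'))
    have i3 := (integrable_ind μ (hE τ')).const_mul (μ.real (E τ))
    have i4 := (i1.sub i2).sub i3
    refine ⟨by rw [e]; exact i4.add (integrable_const _), ?_⟩
    rw [e]
    have s1 := integral_add i4 (integrable_const (μ := μ) (μ.real (E τ) * μ.real (E τ')))
    have s2 := integral_sub (i1.sub i2) i3
    have s3 := integral_sub i1 i2
    simp only [Pi.sub_apply] at s1 s2 s3
    rw [s1, s2, s3, integral_const_mul, integral_const_mul, integral_indicator_one ((hE τ).inter (hE τ')),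
      integral_indicator_one (hE τ), integral_indicator_one (hE τ')]
    simp
    ring
  have hXS : ∀ ω, (X ω - S) ^ 2 = ∑ τ, ∑ τ', ((E τ).indicator (1 : Ω → ℝ) ω - μ.real (E τ)) *
      ((E τ').indicator (1 : Ω → ℝ) ω - μ.real (E τ')) := by
    intro ω
    simp only [hX]
    rw [hS, ← Finset.sum_sub_distrib, sq, Finset.sum_mul_sum]
  have hVi : Integrable (fun ω => (X ω - S) ^ 2) μ := by
    simp_rw [hXS]
    exact integrable_finsetSum _ fun τ _ => integrable_finsetSum _ fun τ' _ => (hp τ τ').1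
  have hV : ∫ ω, (X ω - S) ^ 2 ∂μ ≤ B := by
    simp_rw [hXS]
    rw [integral_finsetSum _ fun τ _ => integrable_finsetSum _ fun τ' _ => (hp τ τ').1]
    refine le_trans (Finset.sum_le_sum fun τ _ => ?_) h3
    rw [integral_finsetSum _ fun τ' _ => (hp τ τ').1]
    refine Finset.sum_le_sum fun τ' _ => ?_
    rw [(hp τ τ').2]
    split_ifs with hb
    · have := mul_nonneg (measureReal_nonneg (μ := μ) (s := E τ)) (measureReal_nonneg (μ := μ) (s := E τ'))
      linarith
    · rw [h1 τ τ' hb]; simp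
  calc _ ≤ μ.real ({ω | S ^ 2 / 4 ≤ (X ω - S) ^ 2} ∪ {ω | S / 4 ≤ Y ω}) := measureReal_mono hsub
    _ ≤ _ := measureReal_union_le _ _
    _ ≤ _ := by
      have a1 := markov_real μ _ hVi (fun ω => sq_nonneg _) (S ^ 2 / 4) (by positivity)
      have a2 := markov_real μ _ hYi (fun ω => Finset.sum_nonneg fun τ _ =>
        Set.indicator_nonneg (fun _ _ => zero_le_one) _) (S / 4) (by positivity)
      refine add_le_add (a1.trans ?_) (a2.trans ?_)
      · rw [div_le_div_iff₀ (by positivity) (by positivity)]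
        nlinarith [mul_le_mul_of_nonneg_right hV (sq_nonneg S)]
      · rw [div_le_iff₀ (by positivity)]
        linarith

end second

section bayes
variable {n d : ℕ}

lemma bayes_eq (ρ r : ℝ) (est : Obs n d → Equiv.Perm (Fin n)) (hest : Measurable est) :
    bayesLaw n d ρ r {p : Equiv.Perm (Fin n) × Obs n d | est p.2 ≠ p.1} =
      ENNReal.ofReal (1 - (∑ π, (PP n d ρ r).real {ω | est (ob π ω) = π}) / (n.factorial : ℝ)) := by
  have hmeas : MeasurableSet {p : Equiv.Perm (Fin n) × Obs n d | est p.2 ≠ p.1} := by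
    have : {p : Equiv.Perm (Fin n) × Obs n d | est p.2 ≠ p.1} =
        ⋃ π : Equiv.Perm (Fin n), {π} ×ˢ (est ⁻¹' {π}ᶜ) := by
      ext ⟨π, o⟩; simp
    rw [this]
    refine MeasurableSet.iUnion fun π => MeasurableSet.prod ?_ (hest ?_) <;> trivial
  have hA : ∀ π, MeasurableSet {ω : Idx n d → ℝ × ℝ | est (ob π ω) = π} := fun π =>
    (hest.comp (measurable_ob π)) (t := {π}) trivial
  have h1 : ∀ π : Equiv.Perm (Fin n), Measure.map (fun o => (π, o)) (obsLaw n d ρ r π)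
      {p : Equiv.Perm (Fin n) × Obs n d | est p.2 ≠ p.1} =
       ENNReal.ofReal (1 - (PP n d ρ r).real {ω | est (ob π ω) = π}) := by
    intro π
    rw [obsLaw_eq, Measure.map_apply measurable_prodMk_left hmeas,
      Measure.map_apply (measurable_ob π) (measurable_prodMk_left hmeas),
      ← probReal_compl_eq_one_sub (hA π), ofReal_measureReal]
    rfl
  unfold bayesLaw
  rw [Measure.smul_apply, Measure.finsetSum_apply, Finset.sum_congr rfl fun π _ => h1 π,
    ← ENNReal.ofReal_sum_of_nonneg (fun π _ => by
      have := measureReal_le_one (μ := PP n d ρ r) (s := {ω | est (ob π ω) = π}); linarith)]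
  have hf : (0 : ℝ) < n.factorial := by exact_mod_cast n.factorial_pos
  rw [smul_eq_mul, ← ENNReal.ofReal_natCast, ← ENNReal.ofReal_inv_of_pos hf, ← ENNReal.ofReal_mul (by positivity)]
  congr 1
  rw [Finset.sum_sub_distrib]
  simp only [Finset.sum_const, Finset.card_univ, Fintype.card_perm, Fintype.card_fin, nsmul_eq_mul, mul_one]
  field_simp

lemma act_act (τ : Equiv.Perm (Fin n)) (hτ : τ⁻¹ = τ) (i : Idx n d) : act τ (act τ i) = i := by
  have h : ∀ x, τ (τ x) = x := fun x => by
    nth_rewrite 1 [← hτ]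
    simp
  rcases i with e | ⟨x, i⟩
  · induction e using Sym2.ind with
    | _ x y => simp [act, h]
  · simp [act, h]

lemma measurable_Dall {I : Type*} [Fintype I] (c : I → ℝ) (e : I → I) : Measurable (Dall c e) := by
  unfold Dall; fun_prop

lemma LR_ob (ρ r : ℝ) (hρ : ρ ^ 2 < 1) (hr : r ^ 2 < 1) (est : Obs n d → Equiv.Perm (Fin n))
    (hest : Measurable est) (π τ : Equiv.Perm (Fin n)) (hτ : τ⁻¹ = τ) (M : ℝ) :
    (PP n d ρ r).real ({ω | est (ob π ω) = π} ∩ {ω | Dall (cc ρ r) (act τ) ω ≤ M}) ≤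
      Real.exp M * (PP n d ρ r).real {ω | est (ob (π * τ) ω) = π} := by
  have h := LR (cc (n := n) (d := d) ρ r) (by rintro (i | i) <;> assumption)
    (Function.Involutive.toPerm (act τ) (act_act τ hτ)) (act_act τ hτ)
    (by rintro (i | i) <;> rfl) {ω | est (ob π ω) = π}
    ((hest.comp (measurable_ob π)) (t := {π}) trivial) M
  have e : (sig (Function.Involutive.toPerm (act τ) (act_act τ hτ)) ⁻¹' {ω : Idx n d → ℝ × ℝ | est (ob π ω) = π})
     = {ω | est (ob (π * τ) ω) = π} := by
    ext ω
    simp only [Set.mem_preimage, Set.mem_ofPred_eq]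
    rw [ob_mul _ _ hτ]
    rfl
  rw [e] at h
  have h2 := ENNReal.toReal_mono (ENNReal.mul_ne_top ENNReal.ofReal_ne_top (measure_ne_top _ _)) h
  rw [ENNReal.toReal_mul, ENNReal.toReal_ofReal (Real.exp_nonneg _)] at h2
  exact h2

lemma bayes_bound {T : Type*} [Fintype T] (ρ r : ℝ) (hρ : ρ ^ 2 < 1) (hr : r ^ 2 < 1)
    (est : Obs n d → Equiv.Perm (Fin n)) (hest : Measurable est) (τ : T → Equiv.Perm (Fin n))
    (hinj : Function.Injective τ) (hτ : ∀ t, (τ t)⁻¹ = τ t) (M K : ℝ) (hK : 0 < K) :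
    (∑ π, (PP n d ρ r).real {ω | est (ob π ω) = π}) / (n.factorial : ℝ) ≤
      (PP n d ρ r).real {ω | ∑ t, {ω : Idx n d → ℝ × ℝ | Dall (cc ρ r) (act (τ t)) ω ≤ M}.indicator (1 : (Idx n d → ℝ × ℝ) → ℝ) ω < K}
        + Real.exp M / K := by
  set μ := PP n d ρ r with hμ
  set G : T → Set (Idx n d → ℝ × ℝ) := fun t => {ω | Dall (cc ρ r) (act (τ t)) ω ≤ M} with hG
  have hGm : ∀ t, MeasurableSet (G t) := fun t => measurableSet_le (measurable_Dall _ _) measurable_const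
  have hA : ∀ π π', MeasurableSet {ω : Idx n d → ℝ × ℝ | est (ob π ω) = π'} := fun π π' =>
    (hest.comp (measurable_ob π)) (t := {π'}) trivial
  have step : ∀ π, μ.real {ω | est (ob π ω) = π} ≤ μ.real {ω | ∑ t, (G t).indicator (1 : (Idx n d → ℝ × ℝ) → ℝ) ω < K}
      + Real.exp M / K * ∑ t, μ.real {ω | est (ob (π * τ t) ω) = π} := by
    intro π
    set A := {ω : Idx n d → ℝ × ℝ | est (ob π ω) = π} with hAd
    have hint : ∀ t, Integrable ((A ∩ G t).indicator (1 : (Idx n d → ℝ × ℝ) → ℝ)) μ := fun t =>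
      integrable_ind μ ((hA π π).inter (hGm t))
    have hsub : A ⊆ {ω | ∑ t, (G t).indicator (1 : (Idx n d → ℝ × ℝ) → ℝ) ω < K} ∪
        {ω | K ≤ ∑ t, (A ∩ G t).indicator (1 : (Idx n d → ℝ × ℝ) → ℝ) ω} := by
      intro ω hω
      by_cases h : ∑ t, (G t).indicator (1 : (Idx n d → ℝ × ℝ) → ℝ) ω < K
      · exact Or.inl h
      · right
        have : ∑ t, (A ∩ G t).indicator (1 : (Idx n d → ℝ × ℝ) → ℝ) ω = ∑ t, (G t).indicator (1 : (Idx n d → ℝ × ℝ) → ℝ) ω :=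
          Finset.sum_congr rfl fun t _ => by
            rw [Set.inter_indicator_one]; simp [hω]
        simp only [Set.mem_ofPred_eq, this]
        exact not_lt.mp h
    have hm := markov_real μ (fun ω => ∑ t, (A ∩ G t).indicator (1 : (Idx n d → ℝ × ℝ) → ℝ) ω)
      (integrable_finsetSum _ fun t _ => hint t)
      (fun ω => Finset.sum_nonneg fun t _ => Set.indicator_nonneg (fun _ _ => zero_le_one) _) K hK
    rw [integral_finsetSum _ fun t _ => hint t] at hm
    calc μ.real A ≤ _ := measureReal_mono hsub
      _ ≤ _ := measureReal_union_le _ _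
      _ ≤ _ := by
        gcongr
        refine hm.trans ?_
        rw [div_mul_eq_mul_div, Finset.mul_sum]
        gcongr with t
        rw [integral_indicator_one ((hA π π).inter (hGm t))]
        exact LR_ob ρ r hρ hr est hest π (τ t) (hτ t) M
  have hsum : ∑ π, ∑ t, μ.real {ω | est (ob (π * τ t) ω) = π} ≤ n.factorial := by
    have e : ∑ π, ∑ t, μ.real {ω | est (ob (π * τ t) ω) = π} = ∑ π, ∑ t, μ.real {ω | est (ob π ω) = π * τ t} := by
      rw [Finset.sum_comm]
      conv_rhs => rw [Finset.sum_comm]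
      refine Finset.sum_congr rfl fun t _ => ?_
      rw [← Equiv.sum_comp (Equiv.mulRight (τ t)) (fun π => μ.real {ω | est (ob π ω) = π * τ t})]
      refine Finset.sum_congr rfl fun π _ => ?_
      have : π * τ t * τ t = π := by
        rw [mul_assoc]; nth_rewrite 1 [← hτ t]; simp
      simp [this]
    rw [e]
    have : ∀ π : Equiv.Perm (Fin n), ∑ t, μ.real {ω | est (ob π ω) = π * τ t} ≤ 1 := by
      intro π
      rw [← measureReal_biUnion_finset ?_ (fun t _ => hA _ _)]
      · exact measureReal_le_one
      · intro a _ b _ hab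
        refine Set.disjoint_left.mpr fun ω h1 h2 => ?_
        simp only [Set.mem_ofPred_eq] at h1 h2
        exact hab (hinj (mul_left_cancel (h1.symm.trans h2)))
    calc _ ≤ ∑ π : Equiv.Perm (Fin n), (1 : ℝ) := Finset.sum_le_sum fun π _ => this π
      _ = _ := by simp [Fintype.card_perm]
  have hf : (0 : ℝ) < n.factorial := by exact_mod_cast n.factorial_pos
  rw [div_le_iff₀ hf]
  calc _ ≤ ∑ π : Equiv.Perm (Fin n), (μ.real {ω | ∑ t, (G t).indicator (1 : (Idx n d → ℝ × ℝ) → ℝ) ω < K}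
      + Real.exp M / K * ∑ t, μ.real {ω | est (ob (π * τ t) ω) = π}) := Finset.sum_le_sum fun π _ => step π
    _ = n.factorial * μ.real {ω | ∑ t, (G t).indicator (1 : (Idx n d → ℝ × ℝ) → ℝ) ω < K} +
         Real.exp M / K * ∑ π, ∑ t, μ.real {ω | est (ob (π * τ t) ω) = π} := by
        rw [Finset.sum_add_distrib, ← Finset.mul_sum]; simp [Fintype.card_perm]
    _ ≤ n.factorial * μ.real {ω | ∑ t, (G t).indicator (1 : (Idx n d → ℝ × ℝ) → ℝ) ω < K} +
         Real.exp M / K * n.factorial := by gcongr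
    _ = _ := by ring

end bayes


section gen
variable {Ω : Type*} [MeasurableSpace Ω] (μ : Measure Ω) [IsProbabilityMeasure μ]

lemma chernoff (f : Ω → ℝ) (hf : Measurable f) (C a : ℝ) (hC : 0 ≤ C)
    (h : ∫⁻ ω, ENNReal.ofReal (Real.exp (f ω)) ∂μ ≤ ENNReal.ofReal C) :
    μ.real {ω | a ≤ f ω} ≤ C * Real.exp (-a) := by
  have h1 := mul_meas_ge_le_lintegral (μ := μ) (f := fun ω => ENNReal.ofReal (Real.exp (f ω)))
    (by fun_prop) (ENNReal.ofReal (Real.exp a))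
  have e : {ω | ENNReal.ofReal (Real.exp a) ≤ ENNReal.ofReal (Real.exp (f ω))} = {ω | a ≤ f ω} := by
    ext ω
    simp only [Set.mem_ofPred_eq]
    rw [ENNReal.ofReal_le_ofReal_iff (Real.exp_nonneg _), Real.exp_le_exp]
  rw [e] at h1
  have h2 := ENNReal.toReal_mono ENNReal.ofReal_ne_top (h1.trans h)
  rw [ENNReal.toReal_mul, ENNReal.toReal_ofReal (Real.exp_nonneg _), ENNReal.toReal_ofReal hC] at h2
  have h3 : Real.exp a * μ.real {ω | a ≤ f ω} ≤ C := h2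
  rw [Real.exp_neg, ← div_eq_mul_inv, le_div_iff₀ (Real.exp_pos _)]
  linarith

lemma lower (D : Ω → ℝ) (hD : Measurable D) (s M q q1 q2 : ℝ) (hs : 0 ≤ s) (hM : 0 ≤ M)
    (hq : 0 ≤ q) (hq1 : 0 ≤ q1) (hq2 : 0 ≤ q2)
    (h : ENNReal.ofReal q ≤ ∫⁻ ω, ENNReal.ofReal (Real.exp (-(1/2) * D ω)) ∂μ)
    (h1 : ∫⁻ ω, ENNReal.ofReal (Real.exp (-(1/2 - s) * D ω)) ∂μ ≤ ENNReal.ofReal q1)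
    (h2 : ∫⁻ ω, ENNReal.ofReal (Real.exp (-(1/2 + s) * D ω)) ∂μ ≤ ENNReal.ofReal q2) :
    q ≤ Real.exp (-(s * M)) * (q1 + q2) + Real.exp (M / 2) * μ.real {ω | D ω ≤ M} := by
  have hA : MeasurableSet {ω | D ω ≤ M} := measurableSet_le hD measurable_const
  have pt : ∀ ω, ENNReal.ofReal (Real.exp (-(1/2) * D ω)) ≤
      ENNReal.ofReal (Real.exp (-(s * M))) * (ENNReal.ofReal (Real.exp (-(1/2 - s) * D ω)) +
       ENNReal.ofReal (Real.exp (-(1/2 + s) * D ω))) +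
       ENNReal.ofReal (Real.exp (M / 2)) * {ω | D ω ≤ M}.indicator 1 ω := by
    intro ω
    rw [mul_add, ← ENNReal.ofReal_mul (Real.exp_nonneg _), ← ENNReal.ofReal_mul (Real.exp_nonneg _),
      ← Real.exp_add, ← Real.exp_add]
    by_cases c1 : D ω ≤ M
    · by_cases c2 : -M ≤ D ω
      · refine le_trans ?_ le_add_self
        rw [Set.indicator_of_mem (by exact c1)]
        simp only [Pi.one_apply, mul_one]
        apply ENNReal.ofReal_le_ofReal
        apply Real.exp_le_exp.mpr
        linarith
      · refine le_trans ?_ le_self_add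
        refine le_trans ?_ le_add_self
        apply ENNReal.ofReal_le_ofReal
        apply Real.exp_le_exp.mpr
        nlinarith
    · refine le_trans ?_ le_self_add
      refine le_trans ?_ le_self_add
      apply ENNReal.ofReal_le_ofReal
      apply Real.exp_le_exp.mpr
      nlinarith
  have key := h.trans (lintegral_mono pt)
  rw [lintegral_add_left (by fun_prop), lintegral_const_mul _ (by fun_prop), lintegral_add_left (by fun_prop),
    lintegral_const_mul _ (measurable_one.indicator hA), lintegral_indicator_one hA] at key
  have key2 : ENNReal.ofReal q ≤ ENNReal.ofReal (Real.exp (-(s * M)) * (q1 + q2) + Real.exp (M / 2) * μ.real {ω | D ω ≤ M}) := by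
    rw [ENNReal.ofReal_add (by positivity) (by positivity), ENNReal.ofReal_mul (Real.exp_nonneg _),
      ENNReal.ofReal_mul (Real.exp_nonneg _), ENNReal.ofReal_add hq1 hq2, ofReal_measureReal]
    refine key.trans ?_
    gcongr
  rwa [ENNReal.ofReal_le_ofReal_iff (by positivity)] at key2

end gen

lemma F2_nonneg (c t : ℝ) : 0 ≤ F2 c t := by unfold F2; positivity

lemma bern (x p : ℝ) (hx : x < 1) (hp : 0 ≤ p) (hp1 : p ≤ 1) : (1 - x) ^ p ≤ 1 - p * x := by
  have := rpow_one_add_le_one_add_mul_self (s := -x) (by linarith) hp hp1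
  have e : 1 + -x = 1 - x := by ring
  rw [e] at this; linarith

lemma F2_half (c : ℝ) (hc : c ^ 2 < 1) : F2 c (1/2) = Real.exp (Real.log (1 - c ^ 2) / 2) := by
  have h : 0 < 1 - c ^ 2 := by linarith
  unfold F2
  norm_num
  rw [Real.exp_half, Real.exp_log h]

lemma F2_le (c s : ℝ) (hc : c ^ 2 < 1) (t : ℝ) (ht : (1 - 2 * t) ^ 2 = 4 * s ^ 2) (hs : 4 * s ^ 2 ≤ 1) :
    F2 c t ≤ Real.exp ((1 - 4 * s ^ 2) * Real.log (1 - c ^ 2) / 2) := by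
  have h : 0 < 1 - c ^ 2 := by linarith
  unfold F2
  rw [ht, Real.exp_half]
  have hb := bern (c ^ 2) (4 * s ^ 2) hc (by positivity) hs
  have hp : 0 < (1 - c ^ 2) ^ (4 * s ^ 2) := Real.rpow_pos_of_pos h _
  rw [← Real.sqrt_inv, inv_div]
  apply Real.sqrt_le_sqrt
  have e : Real.exp ((1 - 4 * s ^ 2) * Real.log (1 - c ^ 2)) = (1 - c ^ 2) / (1 - c ^ 2) ^ (4 * s ^ 2) := by
    rw [mul_comm, ← Real.rpow_def_of_pos h, Real.rpow_sub h, Real.rpow_one]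
  rw [e]
  apply div_le_div_of_nonneg_left h.le hp
  linarith

lemma F3_le (c : ℝ) (hc : c ^ 2 < 1) : F3 c ≤ Real.exp (3 / 4 * Real.log (1 - c ^ 2)) := by
  have h : 0 < 1 - c ^ 2 := by linarith
  unfold F3
  have hb := bern (c ^ 2) (1/4) hc (by norm_num) (by norm_num)
  have hp : 0 < (1 - c ^ 2) ^ (1/4 : ℝ) := Real.rpow_pos_of_pos h _
  have e : Real.exp (3 / 4 * Real.log (1 - c ^ 2)) = (1 - c ^ 2) / (1 - c ^ 2) ^ (1/4 : ℝ) := by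
    rw [mul_comm, ← Real.rpow_def_of_pos h, ← Real.rpow_one_sub' h.le (by norm_num)]
    norm_num
  rw [e]
  apply div_le_div_of_nonneg_left h.le hp
  linarith

lemma F3_nonneg (c : ℝ) (hc : c ^ 2 < 1) : 0 ≤ F3 c := by
  unfold F3
  apply div_nonneg <;> nlinarith [sq_nonneg c]

lemma F2_neg_one (c : ℝ) (hc : 9 * c ^ 2 ≤ 1 / 2) : F2 c (-1) ≤ Real.exp (9 * c ^ 2) := by
  unfold F2
  have h : 0 < 1 - c ^ 2 := by nlinarith [sq_nonneg c]
  have h9 : 0 < 1 - 9 * c ^ 2 := by linarith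
  have e : Real.exp (9 * c ^ 2) = √(Real.exp (2 * (9 * c ^ 2))) := by
    rw [← Real.exp_half]; congr 1; ring
  rw [e, ← Real.sqrt_inv, inv_div]
  apply Real.sqrt_le_sqrt
  have e2 : (1 - c ^ 2 * (1 - 2 * -1) ^ 2) = 1 - 9 * c ^ 2 := by ring
  rw [e2, div_le_iff₀ h9]
  have := Real.add_one_le_exp (2 * (9 * c ^ 2))
  nlinarith [sq_nonneg c]

lemma ofReal_pow_mul_le (a b A B : ℝ) (k d : ℕ) (ha : 0 ≤ a) (hb : 0 ≤ b) (h1 : a ≤ Real.exp A) (h2 : b ≤ Real.exp B) :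
    ENNReal.ofReal a ^ k * ENNReal.ofReal b ^ d ≤ ENNReal.ofReal (Real.exp (k * A + d * B)) := by
  rw [← ENNReal.ofReal_pow ha, ← ENNReal.ofReal_pow hb, ← ENNReal.ofReal_mul (by positivity)]
  apply ENNReal.ofReal_le_ofReal
  rw [Real.exp_add, Real.exp_nat_mul, Real.exp_nat_mul]
  gcongr

section fixed
variable {n d : ℕ}

noncomputable def Lam (n d L : ℕ) (ρ r : ℝ) : ℝ :=
  -(((n - L : ℕ) : ℝ) * Real.log (1 - ρ ^ 2) + (d : ℝ) * Real.log (1 - r ^ 2))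

lemma p_lower {L : ℕ} (hL : L ≤ n) (ρ r : ℝ) (hρ : ρ ^ 2 < 1) (hr : r ^ 2 < 1)
    {u v : Fin n} (hu : u.val < L) (hv : v.val < L) (huv : u ≠ v) (δ l : ℝ) (hδ : 0 < δ) (hδ1 : δ ≤ 1) (hl : 0 ≤ l)
    (hΛ : Lam n d L ρ r ≤ 4 * l) (hb : 2 * Real.exp (-(δ ^ 2 * l / 32)) ≤ 1 / 2) :
    1 / 2 * Real.exp (-(δ * l + Lam n d L ρ r) / 2) ≤ (PP n d ρ r).real {ω | D0 L ρ r u v ω ≤ δ * l} := by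
  set Λ := Lam n d L ρ r with hΛd
  have hs : 4 * (δ / 16) ^ 2 ≤ 1 := by nlinarith
  have m0 := mgf_D0 (d := d) hL ρ r hρ hr (1/2) (by norm_num) hu hv huv
  have m1 := mgf_D0 (d := d) hL ρ r hρ hr (1/2 - δ/16) (by nlinarith) hu hv huv
  have m2 := mgf_D0 (d := d) hL ρ r hρ hr (1/2 + δ/16) (by nlinarith) hu hv huv
  have hq : ∀ t, (1 - 2 * t) ^ 2 = 4 * (δ/16) ^ 2 →
      ENNReal.ofReal (F2 ρ t) ^ (n - L) * ENNReal.ofReal (F2 r t) ^ d ≤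
        ENNReal.ofReal (Real.exp (-Λ / 2 + δ ^ 2 * l / 32)) := by
    intro t ht
    refine (ofReal_pow_mul_le _ _ _ _ _ _ (F2_nonneg _ _) (F2_nonneg _ _) (F2_le ρ (δ/16) hρ t ht hs)
      (F2_le r (δ/16) hr t ht hs)).trans ?_
    apply ENNReal.ofReal_le_ofReal
    apply Real.exp_le_exp.mpr
    have : ((n - L : ℕ) : ℝ) * ((1 - 4 * (δ / 16) ^ 2) * Real.log (1 - ρ ^ 2) / 2) +
        d * ((1 - 4 * (δ / 16) ^ 2) * Real.log (1 - r ^ 2) / 2) = - Λ / 2 + δ ^ 2 / 128 * Λ := by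
      rw [hΛd, Lam]; ring
    rw [this]
    have := mul_le_mul_of_nonneg_left hΛ (by positivity : 0 ≤ δ ^ 2 / 128)
    linarith
  have hq0 : ENNReal.ofReal (Real.exp (-Λ / 2)) ≤ ENNReal.ofReal (F2 ρ (1/2)) ^ (n - L) * ENNReal.ofReal (F2 r (1/2)) ^ d := by
    rw [← ENNReal.ofReal_pow (F2_nonneg _ _), ← ENNReal.ofReal_pow (F2_nonneg _ _), ← ENNReal.ofReal_mul (by have := F2_nonneg ρ (1/2); positivity),
      F2_half ρ hρ, F2_half r hr, ← Real.exp_nat_mul, ← Real.exp_nat_mul, ← Real.exp_add]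
    apply le_of_eq
    congr 2
    rw [hΛd, Lam]; ring
  have key := lower (PP n d ρ r) (D0 L ρ r u v) (measurable_D0 _ _ _ _ _) (δ / 16) (δ * l) (Real.exp (-Λ / 2))
    (Real.exp (-Λ / 2 + δ ^ 2 * l / 32)) (Real.exp (-Λ / 2 + δ ^ 2 * l / 32)) (by positivity) (by positivity)
    (by positivity) (by positivity) (by positivity) (hq0.trans_eq m0.symm)
    (m1.trans_le (hq _ (by ring))) (m2.trans_le (hq _ (by ring)))
  set p := (PP n d ρ r).real {ω | D0 L ρ r u v ω ≤ δ * l}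
  have e1 : Real.exp (-(δ / 16 * (δ * l))) * (Real.exp (-Λ / 2 + δ ^ 2 * l / 32) + Real.exp (-Λ / 2 + δ ^ 2 * l / 32))
     = Real.exp (-Λ / 2) * (2 * Real.exp (-(δ ^ 2 * l / 32))) := by
    have e0 : Real.exp (-(δ / 16 * (δ * l))) * Real.exp (-Λ / 2 + δ ^ 2 * l / 32)
        = Real.exp (-Λ / 2) * Real.exp (-(δ ^ 2 * l / 32)) := by
      rw [← Real.exp_add, ← Real.exp_add]; congr 1; ring
    linear_combination 2 * e0
  rw [e1] at key
  have h3 : Real.exp (-Λ / 2) * (1 / 2) ≤ Real.exp (δ * l / 2) * p := by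
    nlinarith [Real.exp_pos (-Λ / 2)]
  have e2 : 1 / 2 * Real.exp (-(δ * l + Λ) / 2) = Real.exp (-(δ * l / 2)) * (Real.exp (-Λ / 2) * (1 / 2)) := by
    rw [← mul_assoc, ← Real.exp_add, mul_comm]; congr 2; ring
  rw [e2]
  calc _ ≤ Real.exp (-(δ * l / 2)) * (Real.exp (δ * l / 2) * p) := by gcongr
    _ = p := by rw [← mul_assoc, ← Real.exp_add]; simp

lemma p3_upper {L : ℕ} (hL : L ≤ n) (ρ r : ℝ) (hρ : ρ ^ 2 < 1) (hr : r ^ 2 < 1)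
    {u v v' : Fin n} (hu : u.val < L) (hv : v.val < L) (hv' : v'.val < L) (huv : u ≠ v) (huv' : u ≠ v')
    (hvv' : v ≠ v') (M : ℝ) :
    (PP n d ρ r).real ({ω | D0 L ρ r u v ω ≤ M} ∩ {ω | D0 L ρ r u v' ω ≤ M})
      ≤ Real.exp (M - 3 / 4 * Lam n d L ρ r) := by
  have h := mgf_D03 (d := d) hL ρ r hρ hr hu hv hv' huv huv' hvv'
  have h2 := chernoff (PP n d ρ r) (fun ω => -(1/2) * (D0 L ρ r u v ω + D0 L ρ r u v' ω))
    (((measurable_D0 _ _ _ _ _).add (measurable_D0 _ _ _ _ _)).const_mul _) _ (-M) (Real.exp_nonneg _)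
    (h.trans_le (ofReal_pow_mul_le _ _ _ _ _ _ (F3_nonneg _ hρ) (F3_nonneg _ hr) (F3_le ρ hρ) (F3_le r hr)))
  refine le_trans (measureReal_mono ?_) (h2.trans_eq ?_)
  · rintro ω ⟨h1, h2⟩
    simp only [Set.mem_ofPred_eq] at h1 h2 ⊢
    linarith
  · rw [← Real.exp_add]; congr 1; rw [Lam]; ring

lemma RR_upper {L : ℕ} (hL : L ≤ n) (ρ r : ℝ) (hρ : 9 * ρ ^ 2 ≤ 1 / 2) {u v : Fin n} (huv : u ≠ v) (M : ℝ) 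
    (h : 9 * ρ ^ 2 * L ≤ M / 2) :
    (PP n d ρ r).real {ω | M ≤ RR L ρ u v ω} ≤ Real.exp (- (M / 2)) := by
  have h1 := mgf_RR (d := d) (L := L) ρ r (by linarith) huv
  have h2 : ENNReal.ofReal (F2 ρ (-1)) ^ (Fintype.card (JR n L v)) ≤ ENNReal.ofReal (Real.exp (M / 2)) := by
    rw [← ENNReal.ofReal_pow (F2_nonneg _ _)]
    apply ENNReal.ofReal_le_ofReal
    refine (pow_le_pow_left₀ (F2_nonneg _ _) (F2_neg_one ρ hρ) _).trans ?_
    rw [← Real.exp_nat_mul]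
    apply Real.exp_le_exp.mpr
    have : (Fintype.card (JR n L v) : ℝ) ≤ L := by exact_mod_cast card_JR L hL v
    nlinarith [sq_nonneg ρ]
  have h3 := chernoff (PP n d ρ r) _ (measurable_RR L ρ u v) _ M (Real.exp_nonneg _) (h1.trans_le h2)
  refine h3.trans_eq ?_
  rw [← Real.exp_add]; congr 1; ring

lemma fixed_n (m : ℕ) (hm : 0 < m) (hL : 2 * m ≤ n) (ρ r : ℝ) (hρ : 9 * ρ ^ 2 ≤ 1 / 2) (hr : r ^ 2 < 1)
    (δ l : ℝ) (hδ : 0 < δ) (hδ1 : δ ≤ 1) (hl : 0 ≤ l)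
    (hΛ : Lam n d (2 * m) ρ r ≤ 4 * l) (hb : 2 * Real.exp (-(δ ^ 2 * l / 32)) ≤ 1 / 2)
    (hR : 9 * ρ ^ 2 * (2 * m : ℕ) ≤ δ * l / 2)
    (est : Obs n d → Equiv.Perm (Fin n)) (hest : Measurable est) (S0 p3 : ℝ)
    (hS0 : S0 = m ^ 2 * (1 / 2 * Real.exp (-(δ * l + Lam n d (2 * m) ρ r) / 2)))
    (hp3 : p3 = Real.exp (δ * l - 3 / 4 * Lam n d (2 * m) ρ r)) :
    (∑ π, (PP n d ρ r).real {ω | est (ob π ω) = π}) / (n.factorial : ℝ) ≤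
      8 * Real.exp (2 * (δ * l)) / S0 + 8 * m ^ 3 * p3 / S0 ^ 2 + 4 * Real.exp (-(δ * l / 2)) := by
  have hρ1 : ρ ^ 2 < 1 := by nlinarith [sq_nonneg ρ]
  set L := 2 * m with hLd
  set M := δ * l with hM
  set μ := PP n d ρ r with hμ
  have hM0 : 0 ≤ M := by positivity
  set U : Fin m → Fin n := fun i => ⟨i.val, by omega⟩ with hU
  set V : Fin m → Fin n := fun i => ⟨m + i.val, by omega⟩ with hV
  have hUL : ∀ i, (U i).val < L := fun i => by simp only [hU]; omega
  have hVL : ∀ i, (V i).val < L := fun i => by simp only [hV]; omega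
  have hUV : ∀ i j, U i ≠ V j := fun i j h => by
    have := congrArg Fin.val h; simp only [hU, hV] at this; omega
  have hUi : ∀ i j, i ≠ j → U i ≠ U j := fun i j hij h => by
    have := congrArg Fin.val h; simp only [hU] at this; omega
  have hVi : ∀ i j, i ≠ j → V i ≠ V j := fun i j hij h => by
    have := congrArg Fin.val h; simp only [hV] at this; omega
  set E : Fin m × Fin m → Set (Idx n d → ℝ × ℝ) := fun t => {ω | D0 L ρ r (U t.1) (V t.2) ω ≤ M} with hE
  set F : Fin m × Fin m → Set (Idx n d → ℝ × ℝ) := fun t => {ω | M ≤ RR L ρ (U t.1) (V t.2) ω} with hF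
  have hEm : ∀ t, MeasurableSet (E t) := fun t => measurableSet_le (measurable_D0 _ _ _ _ _) measurable_const
  have hFm : ∀ t, MeasurableSet (F t) := fun t => measurableSet_le measurable_const (measurable_RR _ _ _ _)
  set S := ∑ t, μ.real (E t) with hS
  have hS0S : S0 ≤ S := by
    rw [hS0, hS]
    calc _ = ∑ t : Fin m × Fin m, (1 / 2 * Real.exp (-(M + Lam n d L ρ r) / 2)) := by
            rw [Finset.sum_const]; simp; ring
      _ ≤ _ := Finset.sum_le_sum fun t _ => p_lower hL ρ r hρ1 hr (hUL _) (hVL _) (hUV _ _) δ l hδ hδ1 hl hΛ hb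
  have hm' : (0 : ℝ) < m := by exact_mod_cast hm
  have hS00 : 0 < S0 := by rw [hS0]; positivity
  have hSpos : 0 < S := hS00.trans_le hS0S
  have hp30 : 0 ≤ p3 := by rw [hp3]; positivity
  set bad : Fin m × Fin m → Fin m × Fin m → Prop := fun t t' => t.1 = t'.1 ∨ t.2 = t'.2 with hbad
  have hdec : ∀ a b, Decidable (bad a b) := fun a b => by simp only [hbad]; infer_instance
  have h1 : ∀ t t', ¬ bad t t' → μ.real (E t ∩ E t') = μ.real (E t) * μ.real (E t') := by
    intro t t' hb
    simp only [hbad, not_or] at hb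
    have hi := indep_D0_D0 (d := d) ρ r (hUL t.1) (hVL t.2) (hUL t'.1) (hVL t'.2) (hUi _ _ hb.1) (hUV _ _)
      (hUV _ _).symm (hVi _ _ hb.2)
    have := hi.measure_inter_preimage_eq_mul _ _ (measurableSet_Iic (a := M)) (measurableSet_Iic (a := M))
    have h := congrArg ENNReal.toReal this
    rw [ENNReal.toReal_mul] at h
    exact h
  have h2 : ∀ t, μ.real (E t ∩ F t) ≤ Real.exp (-(M / 2)) * μ.real (E t) := by
    intro t
    have hi := indep_D0_RR (d := d) ρ r (hUL t.1) (hVL t.2)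
    have := hi.measure_inter_preimage_eq_mul _ _ (measurableSet_Iic (a := M)) (measurableSet_Ici (a := M))
    have h := congrArg ENNReal.toReal this
    rw [ENNReal.toReal_mul] at h
    have h' : μ.real (E t ∩ F t) = μ.real (E t) * μ.real (F t) := h
    rw [h', mul_comm]
    gcongr
    exact RR_upper hL ρ r hρ (hUV _ _) M hR
  have h3 : ∑ t, ∑ t', (if bad t t' then μ.real (E t ∩ E t') else 0) ≤ S + 2 * m ^ 3 * p3 := by
    have hterm : ∀ t t', (if bad t t' then μ.real (E t ∩ E t') else 0) ≤
        (if t = t' then μ.real (E t) else 0) + ((if t.1 = t'.1 then p3 else 0) + (if t.2 = t'.2 then p3 else 0)) := by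
      intro t t'
      have hn : 0 ≤ (if t.1 = t'.1 then p3 else 0) + (if t.2 = t'.2 then p3 else 0) := by
        split_ifs <;> linarith
      by_cases htt : t = t'
      · subst htt
        have hb : bad t t := Or.inl rfl
        rw [if_pos hb, if_pos rfl, Set.inter_self]
        linarith
      by_cases hb : bad t t'
      · rw [if_pos hb, if_neg htt]
        rcases hb with hb | hb
        · have hne : t.2 ≠ t'.2 := fun h => htt (Prod.ext hb h)
          rw [if_pos hb, if_neg hne]
          have := p3_upper (d := d) hL ρ r hρ1 hr (hUL t.1) (hVL t.2) (hVL t'.2) (hUV _ _) (hUV _ _) (hVi _ _ hne) M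
          rw [← hp3] at this
          simp only [hE, ← hb]
          linarith
        · have hne : t.1 ≠ t'.1 := fun h => htt (Prod.ext h hb)
          rw [if_neg hne, if_pos hb]
          have := p3_upper (d := d) hL ρ r hρ1 hr (hVL t.2) (hUL t.1) (hUL t'.1) (hUV _ _).symm (hUV _ _).symm (hUi _ _ hne) M
          rw [← hp3] at this
          simp_rw [D0_symm L ρ r (V t.2) _] at this
          simp only [hE, ← hb]
          linarith
      · rw [if_neg hb, if_neg htt]; linarith
    refine (Finset.sum_le_sum fun t _ => Finset.sum_le_sum fun t' _ => hterm t t').trans_eq ?_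
    simp_rw [Finset.sum_add_distrib]
    congr 1
    · simp [hS]
    · have a1 : ∀ t : Fin m × Fin m, ∑ t' : Fin m × Fin m, (if t.1 = t'.1 then p3 else 0) = m * p3 := by
        intro t; rw [Fintype.sum_prod_type_right]; simp
      have a2 : ∀ t : Fin m × Fin m, ∑ t' : Fin m × Fin m, (if t.2 = t'.2 then p3 else 0) = m * p3 := by
        intro t; rw [Fintype.sum_prod_type]; simp
      simp_rw [a1, a2]
      simp
      ring
  have hsm := second_moment μ E F hEm hFm bad S _ _ hS hSpos h1 h2 h3
  have hbb := bayes_bound ρ r hρ1 hr est hest (fun t : Fin m × Fin m => Equiv.swap (U t.1) (V t.2))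
    (by
      intro a b hab
      have e := congrArg (fun f : Equiv.Perm (Fin n) => f (U a.1)) hab
      simp only [Equiv.swap_apply_left] at e
      have hab1 : a.1 = b.1 := by
        by_contra hne
        rw [Equiv.swap_apply_of_ne_of_ne (hUi _ _ hne) (hUV _ _)] at e
        exact hUV _ _ e.symm
      rw [hab1, Equiv.swap_apply_left] at e
      have hab2 : a.2 = b.2 := by
        by_contra hne
        exact hVi _ _ hne e
      exact Prod.ext hab1 hab2) (fun t => Equiv.swap_inv _ _) (2 * M) (S / 4) (by positivity)
  refine hbb.trans ?_
  have hmono : μ.real {ω | ∑ t : Fin m × Fin m, {ω : Idx n d → ℝ × ℝ | Dall (cc ρ r) (act (Equiv.swap (U t.1) (V t.2))) ω ≤ 2 * M}.indicator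
      (1 : (Idx n d → ℝ × ℝ) → ℝ) ω < S / 4} ≤
      μ.real {ω | ∑ t, (E t \ F t).indicator (1 : (Idx n d → ℝ × ℝ) → ℝ) ω < S / 4} := by
    refine measureReal_mono ?_
    intro ω hω
    simp only [Set.mem_ofPred_eq] at hω ⊢
    refine lt_of_le_of_lt (Finset.sum_le_sum fun t _ => ?_) hω
    refine Set.indicator_le_indicator_of_subset ?_ (fun _ => zero_le_one) ω
    rintro ω ⟨ha, hb⟩
    simp only [hE, hF, Set.mem_ofPred_eq, not_le] at ha hb ⊢
    rw [D_decomp ρ r (hUL t.1) (hVL t.2) (hUV _ _)]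
    linarith
  have hexp : 1 ≤ Real.exp (2 * M) := Real.one_le_exp (by positivity)
  have b1 : 4 * (S + 2 * m ^ 3 * p3) / S ^ 2 = 4 / S + 8 * m ^ 3 * p3 / S ^ 2 := by
    field_simp; ring
  have b2 : 4 / S ≤ 4 * Real.exp (2 * M) / S0 := by
    apply div_le_div₀ (by positivity) (by linarith) hS00 hS0S
  have b3 : 8 * m ^ 3 * p3 / S ^ 2 ≤ 8 * m ^ 3 * p3 / S0 ^ 2 := by gcongr
  have b4 : Real.exp (2 * M) / (S / 4) ≤ 4 * Real.exp (2 * M) / S0 := by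
    rw [div_div_eq_mul_div, mul_comm]; gcongr
  have b5 : 8 * Real.exp (2 * M) / S0 = 4 * Real.exp (2 * M) / S0 + 4 * Real.exp (2 * M) / S0 := by ring
  rw [b1] at hsm
  rw [b5]
  linarith [hmono.trans hsm]

end fixed


lemma ev_l (δ : ℝ) (hδ : 0 < δ) (hδ1 : δ < 1) : ∀ᶠ l : ℝ in atTop, 1 ≤ l ∧ 2 * Real.exp (-(δ ^ 2 * l / 32)) ≤ 1 / 2 ∧
    72 * (l * Real.exp (-l)) ≤ 1 ∧ 72 * Real.exp (-(δ * l)) ≤ δ / 2 ∧ 2 ≤ Real.exp ((1 - δ) * l) ∧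
    2 ≤ Real.exp (δ * l) := by
  have hexp : ∀ a : ℝ, 0 < a → Tendsto (fun l : ℝ => Real.exp (a * l)) atTop atTop := fun a ha =>
    Real.tendsto_exp_atTop.comp (tendsto_id.const_mul_atTop ha)
  have hexpn : ∀ a : ℝ, 0 < a → Tendsto (fun l : ℝ => Real.exp (-(a * l))) atTop (nhds 0) := fun a ha =>
    Real.tendsto_exp_neg_atTop_nhds_zero.comp (tendsto_id.const_mul_atTop ha)
  have t3 : Tendsto (fun l : ℝ => l * Real.exp (-l)) atTop (nhds 0) := by
    simpa using Real.tendsto_pow_mul_exp_neg_atTop_nhds_zero 1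
  filter_upwards [eventually_ge_atTop 1, (hexpn (δ ^ 2 / 32) (by positivity)).eventually_le_const (show (0:ℝ) < 1/4 by norm_num),
    t3.eventually_le_const (show (0:ℝ) < 1/72 by norm_num),
    (hexpn δ hδ).eventually_le_const (show 0 < δ / 144 by positivity),
    (hexp (1 - δ) (by linarith)).eventually_ge_atTop 2, (hexp δ hδ).eventually_ge_atTop 2] with l a1 a2 a3 a4 a5 a6
  refine ⟨a1, ?_, by linarith, by linarith, a5, a6⟩
  have : δ ^ 2 * l / 32 = δ ^ 2 / 32 * l := by ring
  rw [this]; linarith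

lemma c1_aux (δ l Λ x m : ℝ) (hx : x = Real.exp ((1 - δ) * l)) (hm : 0 < m) (hxm : x / 2 ≤ m) (hdl : 0 < δ * l)
    (hΛ : Λ ≤ (4 - 20 * δ) * l) :
    8 * Real.exp (2 * (δ * l)) / (m ^ 2 * (1 / 2 * Real.exp (-(δ * l + Λ) / 2))) ≤ 64 * Real.exp (-(δ * l / 2)) := by
  have hx0 : 0 < x := by rw [hx]; positivity
  rw [div_le_iff₀ (by positivity)]
  have h1 : Real.exp (2 * (δ * l)) ≤ Real.exp (-(δ * l / 2)) * (x * x) * Real.exp (-(δ * l + Λ) / 2) := by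
    rw [hx, ← Real.exp_add, ← Real.exp_add, ← Real.exp_add]
    apply Real.exp_le_exp.mpr
    linarith
  calc 8 * Real.exp (2 * (δ * l)) ≤ 8 * (Real.exp (-(δ * l / 2)) * (x * x) * Real.exp (-(δ * l + Λ) / 2)) := by linarith
    _ = 64 * Real.exp (-(δ * l / 2)) * ((x / 2) ^ 2 * (1 / 2 * Real.exp (-(δ * l + Λ) / 2))) := by ring
    _ ≤ _ := by gcongr

lemma c2_aux (δ l Λ x m : ℝ) (hx : x = Real.exp ((1 - δ) * l)) (hm : 0 < m) (hxm : x / 2 ≤ m) (hdl : 0 < δ * l)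
    (hΛ : Λ ≤ (4 - 20 * δ) * l) :
    8 * m ^ 3 * Real.exp (δ * l - 3 / 4 * Λ) / (m ^ 2 * (1 / 2 * Real.exp (-(δ * l + Λ) / 2))) ^ 2
      ≤ 64 * Real.exp (-(δ * l / 2)) := by
  rw [div_le_iff₀ (by positivity)]
  have h1 : Real.exp (δ * l - 3 / 4 * Λ) ≤ x * (Real.exp (-(δ * l / 2)) * (Real.exp (-(δ * l + Λ) / 2) * Real.exp (-(δ * l + Λ) / 2))) := by
    rw [hx, ← Real.exp_add, ← Real.exp_add, ← Real.exp_add]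
    apply Real.exp_le_exp.mpr
    linarith
  have e : 64 * Real.exp (-(δ * l / 2)) * (m ^ 2 * (1 / 2 * Real.exp (-(δ * l + Λ) / 2))) ^ 2
       = 8 * m ^ 3 * (2 * m * (Real.exp (-(δ * l / 2)) * (Real.exp (-(δ * l + Λ) / 2) * Real.exp (-(δ * l + Λ) / 2)))) := by ring
  rw [e]
  refine mul_le_mul_of_nonneg_left (h1.trans ?_) (by positivity)
  exact mul_le_mul_of_nonneg_right (by linarith) (by positivity)

set_option maxHeartbeats 1600000 in
lemma step_n {n d : ℕ} (ρ r δ l : ℝ) (hρ : 0 < ρ ∧ ρ < 1) (hr : 0 < r ∧ r < 1) (hδ : 0 < δ) (hδ1 : δ < 1)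
    (hn : (n : ℝ) = Real.exp l)
    (hthr : (n : ℝ) * Real.log (1 / (1 - ρ ^ 2)) + (d : ℝ) * Real.log (1 / (1 - r ^ 2))
        + 4 * Real.log d ≤ (4 - 20 * δ) * l)
    (hl : 1 ≤ l ∧ 2 * Real.exp (-(δ ^ 2 * l / 32)) ≤ 1 / 2 ∧
    72 * (l * Real.exp (-l)) ≤ 1 ∧ 72 * Real.exp (-(δ * l)) ≤ δ / 2 ∧ 2 ≤ Real.exp ((1 - δ) * l) ∧
    2 ≤ Real.exp (δ * l))
    (est : Obs n d → Equiv.Perm (Fin n)) (hest : Measurable est) :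
    (∑ π, (PP n d ρ r).real {ω | est (ob π ω) = π}) / (n.factorial : ℝ) ≤ 132 * Real.exp (-(δ * l / 2)) := by
  obtain ⟨l1, l2, l3, l4, l5, l6⟩ := hl
  have hl0 : 0 < l := by linarith
  have hρ1 : ρ ^ 2 < 1 := by nlinarith
  have hr1 : r ^ 2 < 1 := by nlinarith
  rw [one_div, one_div, Real.log_inv, Real.log_inv] at hthr
  have ha : ρ ^ 2 ≤ -Real.log (1 - ρ ^ 2) := by
    have := Real.log_le_sub_one_of_pos (show 0 < 1 - ρ ^ 2 by linarith); linarith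
  have hb : 0 ≤ -Real.log (1 - r ^ 2) := by
    have := Real.log_le_sub_one_of_pos (show 0 < 1 - r ^ 2 by linarith); nlinarith
  have hlogd : 0 ≤ Real.log d := Real.log_natCast_nonneg d
  have hdb : 0 ≤ (d : ℝ) * -Real.log (1 - r ^ 2) := by positivity
  have hna : (n : ℝ) * ρ ^ 2 ≤ (n : ℝ) * -Real.log (1 - ρ ^ 2) := by gcongr
  have hρle : ρ ^ 2 ≤ 4 * (l * Real.exp (-l)) := by
    have h4 : (n : ℝ) * ρ ^ 2 ≤ 4 * l := by nlinarith
    rw [hn] at h4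
    have := mul_le_mul_of_nonneg_left h4 (Real.exp_nonneg (-l))
    rw [← mul_assoc, ← Real.exp_add] at this
    simp at this
    linarith
  set x := Real.exp ((1 - δ) * l) with hx
  set m := ⌊x⌋₊ with hm
  have hmx : (m : ℝ) ≤ x := Nat.floor_le (by positivity)
  have hxm : x / 2 ≤ m := by have := Nat.lt_floor_add_one x; linarith
  have hm0 : 0 < m := by
    have : (0 : ℝ) < m := by linarith
    exact_mod_cast this
  have hm0' : (0 : ℝ) < m := by exact_mod_cast hm0
  have hxn : Real.exp (δ * l) * x = n := by
    rw [hn, hx, ← Real.exp_add]; congr 1; ring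
  have h2m : 2 * m ≤ n := by
    have : (2 : ℝ) * m ≤ n := by
      rw [← hxn]
      have : 2 * x ≤ Real.exp (δ * l) * x := by gcongr
      linarith
    exact_mod_cast this
  have hxe : Real.exp (-l) * x = Real.exp (-(δ * l)) := by
    rw [hx, ← Real.exp_add]; congr 1; ring
  have hR : 9 * ρ ^ 2 * (2 * m : ℕ) ≤ δ * l / 2 := by
    push_cast
    calc 9 * ρ ^ 2 * (2 * m) ≤ 9 * (4 * (l * Real.exp (-l))) * (2 * x) := by gcongr
      _ = l * (72 * (Real.exp (-l) * x)) := by ring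
      _ ≤ l * (δ / 2) := by rw [hxe]; gcongr
      _ = _ := by ring
  have hΛ : Lam n d (2 * m) ρ r ≤ (4 - 20 * δ) * l := by
    have hc : ((n - 2 * m : ℕ) : ℝ) ≤ n := by exact_mod_cast Nat.sub_le _ _
    have := mul_le_mul_of_nonneg_right hc ((sq_nonneg ρ).trans ha)
    unfold Lam
    linarith
  have hΛ4 : Lam n d (2 * m) ρ r ≤ 4 * l := by nlinarith
  have key := fixed_n (d := d) m hm0 h2m ρ r (by linarith) hr1 δ l hδ hδ1.le hl0.le hΛ4 l2 hR est hest _ _ rfl rfl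
  refine key.trans ?_
  set Λ := Lam n d (2 * m) ρ r with hΛd
  have hdl : 0 < δ * l := by positivity
  clear_value Λ
  have c1 := c1_aux δ l Λ x m hx hm0' hxm hdl hΛ
  have c2 := c2_aux δ l Λ x m hx hm0' hxm hdl hΛ
  linarith

/-- Proposition: impossibility of exact recovery. Under the
featured correlated Gaussian Wigner model with `π*` uniform on `S_n`, if
`r² ≥ 40/d` and `n log(1/(1-ρ²)) + d log(1/(1-r²)) + 4 log d ≤ (4-ε) log n`
(along the sequence), then for any (measurable) estimator `π̂`,
`P[π̂ ≠ π*] = 1 - o(1)` as `n → ∞`. -/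
theorem impossibility_exact
    (d : ℕ → ℕ) (ρ r : ℕ → ℝ) (ε : ℝ)
    (hρ : ∀ n, 0 < ρ n ∧ ρ n < 1) (hr : ∀ n, 0 < r n ∧ r n < 1)
    (hε : 0 < ε)
    (hr40 : ∀ᶠ n : ℕ in atTop, 40 / (d n : ℝ) ≤ r n ^ 2)
    (hthr : ∀ᶠ n : ℕ in atTop,
      (n : ℝ) * Real.log (1 / (1 - ρ n ^ 2)) + (d n : ℝ) * Real.log (1 / (1 - r n ^ 2))
        + 4 * Real.log (d n) ≤ (4 - ε) * Real.log n) :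
    ∀ est : (n : ℕ) → Obs n (d n) → Equiv.Perm (Fin n),
      (∀ n, Measurable (est n)) →
      Tendsto
        (fun n => bayesLaw n (d n) (ρ n) (r n)
          {p : Equiv.Perm (Fin n) × Obs n (d n) | est n p.2 ≠ p.1})
        atTop (nhds 1) := by


  intro est hest
  have hmain : Tendsto (fun n => (∑ π, (PP n (d n) (ρ n) (r n)).real {ω | est n (ob π ω) = π}) / (n.factorial : ℝ))
      atTop (nhds 0) := by
    set δ := min ε 1 / 20 with hδd
    have hmin : 0 < min ε 1 := lt_min hε one_pos
    have hδ : 0 < δ := by positivity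
    have hδ1 : δ < 1 := by have := min_le_right ε 1; rw [hδd]; linarith
    have hlog : Tendsto (fun n : ℕ => Real.log n) atTop atTop :=
      Real.tendsto_log_atTop.comp tendsto_natCast_atTop_atTop
    have hev := hlog.eventually (ev_l δ hδ hδ1)
    have hub : Tendsto (fun n : ℕ => 132 * Real.exp (-(δ * Real.log n / 2))) atTop (nhds 0) := by
      have h1 : Tendsto (fun n : ℕ => δ / 2 * Real.log n) atTop atTop := hlog.const_mul_atTop (by positivity)
      have h2 := (Real.tendsto_exp_neg_atTop_nhds_zero.comp h1).const_mul 132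
      rw [mul_zero] at h2
      refine h2.congr fun n => ?_
      simp only [Function.comp]
      congr 3; ring
    refine squeeze_zero' (Eventually.of_forall fun n => by positivity) ?_ hub
    filter_upwards [hev, hthr, eventually_gt_atTop 0] with n h1 h2 h3
    have hn : (0 : ℝ) < n := by exact_mod_cast h3
    refine step_n (ρ n) (r n) δ (Real.log n) (hρ n) (hr n) hδ hδ1 (Real.exp_log hn).symm ?_ h1 (est n) (hest n)
    refine h2.trans ?_
    have : 20 * δ ≤ ε := by have := min_le_left ε 1; rw [hδd]; linarith
    have h0 : 0 ≤ Real.log n := by linarith [h1.1]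
    gcongr
  have h2 := (tendsto_const_nhds (x := (1 : ℝ))).sub hmain
  have h3 := ENNReal.tendsto_ofReal h2
  simp only [sub_zero, ENNReal.ofReal_one] at h3
  refine h3.congr fun n => ?_
  exact (bayes_eq (ρ n) (r n) (est n) (hest n)).symm

end FCGW
end
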